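/- arXiv:2008.07732 — 4 statements merged into one kernel-verified Lean document; each statement's English description precedes it below -/
import Mathlib

section
/- For any spray G on an open set U ⊆ ℝⁿ (n ≥ 2), define T^i_k := Rⁱ_k − ( R δⁱ_k − (1/2) R_{·k} yⁱ ), where R := (1/(n−1)) R^m_m. Then the χ-curvature satisfies χ_k = −(1/3) T^m_{k·m}, that is, χ_k = −(1/3) ∂T^m_k/∂y^m. -/
open scoped BigOperators

noncomputable section

/-- Points/vectors in local coordinates on an open subset of `ℝⁿ`. -/
abbrev Vec (n : ℕ) := Fin n → ℝ

variable {n : ℕ}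

/-- Partial derivative in the base (`x`) variable, in the `k`-th coordinate direction. -/
noncomputable def pdx (f : Vec n → Vec n → ℝ) (k : Fin n) (x y : Vec n) : ℝ :=
  fderiv ℝ (fun x' => f x' y) x (Pi.single k 1)

/-- Partial derivative in the fiber (`y`) variable, in the `k`-th coordinate direction;
this is the operation denoted by a subscript `·k`. -/
noncomputable def pdy (f : Vec n → Vec n → ℝ) (k : Fin n) (x y : Vec n) : ℝ :=
  fderiv ℝ (fun y' => f x y') y (Pi.single k 1)

/-- Partial derivative of a function of `x` alone. -/
noncomputable def pd (f : Vec n → ℝ) (k : Fin n) (x : Vec n) : ℝ :=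
  fderiv ℝ f x (Pi.single k 1)

/-- `G` is a spray on the open set `U ⊆ ℝⁿ`: the coefficients `Gⁱ(x,y)` are smooth for
`x ∈ U`, `y ≠ 0`, and positively homogeneous of degree `2` in `y`. -/
def IsSpray (U : Set (Vec n)) (G : Fin n → Vec n → Vec n → ℝ) : Prop :=
  (∀ i, ContDiffOn ℝ (⊤ : ℕ∞) (fun p : Vec n × Vec n => G i p.1 p.2)
      (U ×ˢ {y : Vec n | y ≠ 0})) ∧
  (∀ i (x y : Vec n) (lam : ℝ), 0 < lam → G i x (lam • y) = lam ^ 2 * G i x y)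

/-- `N^i_j := ∂G^i/∂y^j`. -/
noncomputable def Nc (G : Fin n → Vec n → Vec n → ℝ) (i j : Fin n) (x y : Vec n) : ℝ :=
  pdy (G i) j x y

/-- `Γ^i_{jk} := ∂²G^i/∂y^j∂y^k`. -/
noncomputable def Ga (G : Fin n → Vec n → Vec n → ℝ) (i j k : Fin n) (x y : Vec n) : ℝ :=
  pdy (Nc G i j) k x y

/-- The horizontal derivative `δf/δx^k := ∂f/∂x^k − N^m_k ∂f/∂y^m`; for a scalar `f` this is
also the horizontal covariant derivative `f_{|k}`. -/
noncomputable def hd (G : Fin n → Vec n → Vec n → ℝ) (f : Vec n → Vec n → ℝ)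
    (k : Fin n) (x y : Vec n) : ℝ :=
  pdx f k x y - ∑ m, Nc G m k x y * pdy f m x y

/-- The four-index Riemann curvature tensor
`R_j{}^i{}_{kl} := δΓⁱ_{jl}/δx^k − δΓⁱ_{jk}/δx^l + Γⁱ_{ks}Γ^s_{jl} − Γ^s_{jk}Γⁱ_{ls}`. -/
noncomputable def Riem4 (G : Fin n → Vec n → Vec n → ℝ) (j i k l : Fin n)
    (x y : Vec n) : ℝ :=
  hd G (Ga G i j l) k x y - hd G (Ga G i j k) l x y
    + ∑ s, (Ga G i k s x y * Ga G s j l x y - Ga G s j k x y * Ga G i l s x y)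

/-- The two-index Riemann curvature `R^i_k := y^j R_j{}^i{}_{kl} y^l`. -/
noncomputable def Riem2 (G : Fin n → Vec n → Vec n → ℝ) (i k : Fin n)
    (x y : Vec n) : ℝ :=
  ∑ j, ∑ l, y j * Riem4 G j i k l x y * y l

/-- The χ-curvature `χ_k := −(1/6)(2 R^m_{k·m} + R^m_{m·k})`. -/
noncomputable def chi (G : Fin n → Vec n → Vec n → ℝ) (k : Fin n) (x y : Vec n) : ℝ :=
  -(1 / 6) * (2 * ∑ m, pdy (Riem2 G m k) m x y + ∑ m, pdy (Riem2 G m m) k x y)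

/-- The scalar `R := (1/(n−1)) R^m_m`. -/
noncomputable def Rsc (G : Fin n → Vec n → Vec n → ℝ) (x y : Vec n) : ℝ :=
  (1 / ((n : ℝ) - 1)) * ∑ m, Riem2 G m m x y

/-- `Π := ∂G^m/∂y^m`. -/
noncomputable def PiG (G : Fin n → Vec n → Vec n → ℝ) (x y : Vec n) : ℝ :=
  ∑ m, Nc G m m x y

/-- The S-curvature of `(G, dV)` for the volume form `dV = σ(x) dx¹⋯dxⁿ`:
`S := Π − y^m ∂(ln σ)/∂x^m`. -/
noncomputable def Scurv (G : Fin n → Vec n → Vec n → ℝ) (σ : Vec n → ℝ)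
    (x y : Vec n) : ℝ :=
  PiG G x y - ∑ m, y m * pd (fun x' => Real.log (σ x')) m x

/-- The spray `Ĝ` associated with `(G, dV)`: `Ĝⁱ := Gⁱ − (S/(n+1)) yⁱ`. -/
noncomputable def Ghat (G : Fin n → Vec n → Vec n → ℝ) (σ : Vec n → ℝ)
    (i : Fin n) (x y : Vec n) : ℝ :=
  G i x y - (Scurv G σ x y / ((n : ℝ) + 1)) * y i

/-- `σ` is the (positive, smooth) density of a volume form `dV = σ(x) dx¹⋯dxⁿ` on `U`. -/
def IsVolumeForm (U : Set (Vec n)) (σ : Vec n → ℝ) : Prop :=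
  ContDiffOn ℝ (⊤ : ℕ∞) σ U ∧ ∀ x ∈ U, 0 < σ x

/-- `G` is of isotropic curvature on `U`: `Rⁱ_k = R δⁱ_k − (1/2) R_{·k} yⁱ`. -/
def IsIsotropicCurv (U : Set (Vec n)) (G : Fin n → Vec n → Vec n → ℝ) : Prop :=
  ∀ x ∈ U, ∀ y : Vec n, y ≠ 0 → ∀ i k,
    Riem2 G i k x y
      = Rsc G x y * (if i = k then 1 else 0) - (1 / 2) * pdy (Rsc G) k x y * y i

/-- `G` is of scalar curvature on `U`: `Rⁱ_k = R δⁱ_k − τ_k yⁱ` for some functions `τ_k`,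
positively homogeneous of degree one in `y`, with `τ_k y^k = R`. -/
def IsScalarCurv (U : Set (Vec n)) (G : Fin n → Vec n → Vec n → ℝ) : Prop :=
  ∃ τ : Fin n → Vec n → Vec n → ℝ,
    (∀ k (x y : Vec n) (lam : ℝ), 0 < lam → τ k x (lam • y) = lam * τ k x y) ∧
    ∀ x ∈ U, ∀ y : Vec n, y ≠ 0 →
      (∑ k, τ k x y * y k) = Rsc G x y ∧
      ∀ i k, Riem2 G i k x y
        = Rsc G x y * (if i = k then 1 else 0) - τ k x y * y i

/-- `f` is smooth in `(x, y)` for `x ∈ U` and `y ≠ 0`. -/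
def SmoothOffZero (U : Set (Vec n)) (f : Vec n → Vec n → ℝ) : Prop :=
  ContDiffOn ℝ (⊤ : ℕ∞) (fun p : Vec n × Vec n => f p.1 p.2) (U ×ˢ {y : Vec n | y ≠ 0})

/-- `f` is positively homogeneous of degree `d` in the fiber variable `y`. -/
def PosHomogeneous (d : ℤ) (f : Vec n → Vec n → ℝ) : Prop :=
  ∀ (x y : Vec n) (lam : ℝ), 0 < lam → f x (lam • y) = lam ^ d * f x y

namespace SmoothOffZero

variable {U : Set (Vec n)} {f g : Vec n → Vec n → ℝ}

lemma differentiableAt (hU : IsOpen U) (hf : SmoothOffZero U f) {x y : Vec n}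
    (hx : x ∈ U) (hy : y ≠ 0) :
    DifferentiableAt ℝ (fun p : Vec n × Vec n => f p.1 p.2) (x, y) :=
  (ContDiffOn.contDiffAt hf ((hU.prod isOpen_ne).mem_nhds (Set.mk_mem_prod hx hy))).differentiableAt
    (by simp)

lemma hasFDerivAt_fiber (hU : IsOpen U) (hf : SmoothOffZero U f) {x y : Vec n}
    (hx : x ∈ U) (hy : y ≠ 0) :
    HasFDerivAt (fun y' => f x y')
      ((fderiv ℝ (fun p : Vec n × Vec n => f p.1 p.2) (x, y)).comp
        (ContinuousLinearMap.inr ℝ (Vec n) (Vec n))) y :=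
  (hf.differentiableAt hU hx hy).hasFDerivAt.comp y (hasFDerivAt_prodMk_right x y)

lemma hasFDerivAt_base (hU : IsOpen U) (hf : SmoothOffZero U f) {x y : Vec n}
    (hx : x ∈ U) (hy : y ≠ 0) :
    HasFDerivAt (fun x' => f x' y)
      ((fderiv ℝ (fun p : Vec n × Vec n => f p.1 p.2) (x, y)).comp
        (ContinuousLinearMap.inl ℝ (Vec n) (Vec n))) x :=
  HasFDerivAt.comp (f := fun x' : Vec n => (x', y)) x
    (hf.differentiableAt hU hx hy).hasFDerivAt (hasFDerivAt_prodMk_left x y)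

lemma differentiableAt_fiber (hU : IsOpen U) (hf : SmoothOffZero U f) {x y : Vec n}
    (hx : x ∈ U) (hy : y ≠ 0) : DifferentiableAt ℝ (fun y' => f x y') y :=
  (hf.hasFDerivAt_fiber hU hx hy).differentiableAt

lemma pdy (hU : IsOpen U) (hf : SmoothOffZero U f) (k : Fin n) : SmoothOffZero U (pdy f k) := by
  refine ((ContDiffOn.fderiv_of_isOpen (m := (⊤ : ℕ∞)) hf (hU.prod isOpen_ne)
    (by simp)).clm_apply (contDiffOn_const (c := ((0 : Vec n), Pi.single k (1 : ℝ))))).congr ?_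
  rintro ⟨x, y⟩ ⟨hx, hy⟩
  simp [_root_.pdy, (hf.hasFDerivAt_fiber hU hx hy).fderiv]

lemma pdx (hU : IsOpen U) (hf : SmoothOffZero U f) (k : Fin n) : SmoothOffZero U (pdx f k) := by
  refine ((ContDiffOn.fderiv_of_isOpen (m := (⊤ : ℕ∞)) hf (hU.prod isOpen_ne)
    (by simp)).clm_apply (contDiffOn_const (c := (Pi.single k (1 : ℝ), (0 : Vec n))))).congr ?_
  rintro ⟨x, y⟩ ⟨hx, hy⟩
  simp [_root_.pdx, (hf.hasFDerivAt_base hU hx hy).fderiv]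

lemma mul (hf : SmoothOffZero U f) (hg : SmoothOffZero U g) :
    SmoothOffZero U (fun x y => f x y * g x y) :=
  ContDiffOn.mul hf hg

lemma add (hf : SmoothOffZero U f) (hg : SmoothOffZero U g) :
    SmoothOffZero U (fun x y => f x y + g x y) :=
  ContDiffOn.add hf hg

lemma sub (hf : SmoothOffZero U f) (hg : SmoothOffZero U g) :
    SmoothOffZero U (fun x y => f x y - g x y) :=
  ContDiffOn.sub hf hg

lemma sum {ι : Type*} {s : Finset ι} {F : ι → Vec n → Vec n → ℝ}
    (hF : ∀ i, SmoothOffZero U (F i)) : SmoothOffZero U (fun x y => ∑ i ∈ s, F i x y) :=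
  ContDiffOn.sum fun i _ => hF i

lemma const (c : ℝ) : SmoothOffZero U (fun _ _ => c) :=
  contDiffOn_const

lemma fiber_coord (i : Fin n) : SmoothOffZero U (fun _ y => y i) :=
  ((contDiff_apply ℝ ℝ i).comp contDiff_snd).contDiffOn

end SmoothOffZero

namespace PosHomogeneous

variable {d e : ℤ} {f g : Vec n → Vec n → ℝ}

lemma pdy (hf : PosHomogeneous d f) (k : Fin n) : PosHomogeneous (d - 1) (pdy f k) := by
  intro x y lam hlam
  have h : (fun y' => f x (lam • y')) = lam ^ d • fun y' => f x y' :=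
    funext fun y' => hf x y' lam hlam
  have h' := congrArg (fun F : Vec n → ℝ => fderiv ℝ F y (Pi.single k 1)) h
  simp only [fderiv_const_smul_field, Pi.smul_apply] at h'
  rw [fderiv_comp_smul (f := fun y' => f x y')] at h'
  simp only [smul_apply, smul_eq_mul] at h'
  rw [zpow_sub_one₀ hlam.ne']
  simp only [_root_.pdy]
  field_simp
  linarith

lemma pdx (hf : PosHomogeneous d f) (k : Fin n) : PosHomogeneous d (pdx f k) := by
  intro x y lam hlam
  have h : (fun x' => f x' (lam • y)) = lam ^ d • fun x' => f x' y :=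
    funext fun x' => hf x' y lam hlam
  simp only [_root_.pdx]
  rw [h, fderiv_const_smul_field]
  simp

lemma mul (hf : PosHomogeneous d f) (hg : PosHomogeneous e g) :
    PosHomogeneous (d + e) (fun x y => f x y * g x y) := by
  intro x y lam hlam
  simp only [hf x y lam hlam, hg x y lam hlam, zpow_add₀ hlam.ne']
  ring

lemma add (hf : PosHomogeneous d f) (hg : PosHomogeneous d g) :
    PosHomogeneous d (fun x y => f x y + g x y) := by
  intro x y lam hlam
  simp only [hf x y lam hlam, hg x y lam hlam, mul_add]

lemma sub (hf : PosHomogeneous d f) (hg : PosHomogeneous d g) :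
    PosHomogeneous d (fun x y => f x y - g x y) := by
  intro x y lam hlam
  simp only [hf x y lam hlam, hg x y lam hlam, mul_sub]

lemma sum {ι : Type*} {s : Finset ι} {F : ι → Vec n → Vec n → ℝ}
    (hF : ∀ i, PosHomogeneous d (F i)) : PosHomogeneous d (fun x y => ∑ i ∈ s, F i x y) := by
  intro x y lam hlam
  simp only [hF _ x y lam hlam, Finset.mul_sum]

lemma const (c : ℝ) : PosHomogeneous (n := n) 0 (fun _ _ => c) := by
  intro x y lam hlam
  simp

lemma fiber_coord (i : Fin n) : PosHomogeneous 1 (fun _ y => y i) := by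
  intro x y lam hlam
  simp

/-- The Euler identity for homogeneous functions in the fiber variable. -/
lemma sum_pdy_mul (hf : PosHomogeneous d f) {x y : Vec n}
    (hd : DifferentiableAt ℝ (fun y' => f x y') y) :
    ∑ m, _root_.pdy f m x y * y m = d * f x y := by
  have hray : HasDerivAt (fun t : ℝ => f x (t • y)) (fderiv ℝ (fun y' => f x y') y y) 1 := by
    have hline : HasDerivAt (fun t : ℝ => t • y) y 1 := by
      simpa using (hasDerivAt_id (1 : ℝ)).smul_const y
    refine HasFDerivAt.comp_hasDerivAt (1 : ℝ) (l := fun y' => f x y') ?_ hline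
    simpa using hd.hasFDerivAt
  have hpow : HasDerivAt (fun t : ℝ => t ^ d * f x y) (d * f x y) 1 := by
    simpa using (hasDerivAt_zpow d (1 : ℝ) (Or.inl one_ne_zero)).mul_const (f x y)
  have heq : (fun t : ℝ => f x (t • y)) =ᶠ[nhds 1] fun t => t ^ d * f x y := by
    filter_upwards [lt_mem_nhds (zero_lt_one' ℝ)] with t ht using hf x y t ht
  rw [← hray.unique (hpow.congr_of_eventuallyEq heq)]
  have hcoord := congrArg (fderiv ℝ (fun y' => f x y') y) (pi_eq_sum_univ' y)
  simpa [_root_.pdy, mul_comm] using hcoord.symm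

end PosHomogeneous

section Spray

variable {U : Set (Vec n)} {G : Fin n → Vec n → Vec n → ℝ}

lemma IsSpray.posHomogeneous (hG : IsSpray U G) (i : Fin n) : PosHomogeneous 2 (G i) :=
  fun x y lam hlam => by exact_mod_cast hG.2 i x y lam hlam

lemma IsSpray.smooth_Ga (hU : IsOpen U) (hG : IsSpray U G) (i j k : Fin n) :
    SmoothOffZero U (Ga G i j k) :=
  (SmoothOffZero.pdy hU (hG.1 i) j).pdy hU k

lemma IsSpray.posHomogeneous_Ga (hG : IsSpray U G) (i j k : Fin n) :
    PosHomogeneous 0 (Ga G i j k) :=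
  ((hG.posHomogeneous i).pdy j).pdy k

lemma IsSpray.smooth_hd (hU : IsOpen U) (hG : IsSpray U G) {f : Vec n → Vec n → ℝ}
    (hf : SmoothOffZero U f) (k : Fin n) : SmoothOffZero U (hd G f k) :=
  (hf.pdx hU k).sub (.sum fun m => (SmoothOffZero.pdy hU (hG.1 m) k).mul (hf.pdy hU m))

lemma IsSpray.posHomogeneous_hd (hG : IsSpray U G) {d : ℤ} {f : Vec n → Vec n → ℝ}
    (hf : PosHomogeneous d f) (k : Fin n) : PosHomogeneous d (hd G f k) := by
  refine (hf.pdx k).sub (.sum fun m => ?_)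
  have h := ((hG.posHomogeneous m).pdy k).mul (hf.pdy m)
  rwa [show (2 - 1 : ℤ) + (d - 1) = d by ring] at h

lemma IsSpray.smooth_Riem4 (hU : IsOpen U) (hG : IsSpray U G) (j i k l : Fin n) :
    SmoothOffZero U (Riem4 G j i k l) :=
  ((hG.smooth_hd hU (hG.smooth_Ga hU i j l) k).sub
    (hG.smooth_hd hU (hG.smooth_Ga hU i j k) l)).add
    (.sum fun s => ((hG.smooth_Ga hU i k s).mul (hG.smooth_Ga hU s j l)).sub
      ((hG.smooth_Ga hU s j k).mul (hG.smooth_Ga hU i l s)))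

lemma IsSpray.posHomogeneous_Riem4 (hG : IsSpray U G) (j i k l : Fin n) :
    PosHomogeneous 0 (Riem4 G j i k l) :=
  ((hG.posHomogeneous_hd (hG.posHomogeneous_Ga i j l) k).sub
    (hG.posHomogeneous_hd (hG.posHomogeneous_Ga i j k) l)).add
    (.sum fun s => ((hG.posHomogeneous_Ga i k s).mul (hG.posHomogeneous_Ga s j l)).sub
      ((hG.posHomogeneous_Ga s j k).mul (hG.posHomogeneous_Ga i l s)))

lemma IsSpray.smooth_Riem2 (hU : IsOpen U) (hG : IsSpray U G) (i k : Fin n) :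
    SmoothOffZero U (Riem2 G i k) :=
  .sum fun j => .sum fun l =>
    ((SmoothOffZero.fiber_coord j).mul (hG.smooth_Riem4 hU j i k l)).mul (.fiber_coord l)

lemma IsSpray.posHomogeneous_Riem2 (hG : IsSpray U G) (i k : Fin n) :
    PosHomogeneous 2 (Riem2 G i k) :=
  .sum fun j => .sum fun l =>
    ((PosHomogeneous.fiber_coord j).mul (hG.posHomogeneous_Riem4 j i k l)).mul (.fiber_coord l)

lemma IsSpray.smooth_Rsc (hU : IsOpen U) (hG : IsSpray U G) : SmoothOffZero U (Rsc G) :=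
  (SmoothOffZero.const _).mul (.sum fun m => hG.smooth_Riem2 hU m m)

lemma IsSpray.posHomogeneous_Rsc (hG : IsSpray U G) : PosHomogeneous 2 (Rsc G) :=
  (PosHomogeneous.const _).mul (.sum fun m => hG.posHomogeneous_Riem2 m m)

/-- The trace of `Rⁱ_k`, differentiated in `y`, is `(n - 1) R_{·k}`. -/
lemma IsSpray.sum_pdy_Riem2_diag (hn : 2 ≤ n) (hU : IsOpen U) (hG : IsSpray U G)
    {x y : Vec n} (hx : x ∈ U) (hy : y ≠ 0) (k : Fin n) :
    ∑ m, pdy (Riem2 G m m) k x y = ((n : ℝ) - 1) * pdy (Rsc G) k x y := by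
  have hn' : (n : ℝ) - 1 ≠ 0 := by
    have : (2 : ℝ) ≤ n := by exact_mod_cast hn
    linarith
  have hdiff : ∀ m ∈ Finset.univ, HasFDerivAt (fun y' => Riem2 G m m x y')
      (fderiv ℝ (fun y' => Riem2 G m m x y') y) y := fun m _ =>
    ((hG.smooth_Riem2 hU m m).differentiableAt_fiber hU hx hy).hasFDerivAt
  have h := ((HasFDerivAt.fun_sum hdiff).const_mul (1 / ((n : ℝ) - 1))).fderiv
  simp only [pdy, Rsc]
  rw [h]
  simp
  field_simp

/-- The divergence of `R_{·k} yⁱ` in the fiber is `(n + 1) R_{·k}`. -/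
lemma IsSpray.sum_pdy_Rsc_mul_coord (hU : IsOpen U) (hG : IsSpray U G)
    {x y : Vec n} (hx : x ∈ U) (hy : y ≠ 0) (k : Fin n) :
    ∑ m, pdy (fun x' y' => pdy (Rsc G) k x' y' * y' m) m x y
      = ((n : ℝ) + 1) * pdy (Rsc G) k x y := by
  have hdiff := ((hG.smooth_Rsc hU).pdy hU k).differentiableAt_fiber hU hx hy
  have heuler := (hG.posHomogeneous_Rsc.pdy k).sum_pdy_mul hdiff
  have hterm : ∀ m, pdy (fun x' y' => pdy (Rsc G) k x' y' * y' m) m x y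
      = pdy (Rsc G) k x y + pdy (pdy (Rsc G) k) m x y * y m := by
    intro m
    have h := (hdiff.hasFDerivAt.mul (hasFDerivAt_apply (𝕜 := ℝ) m y)).fderiv
    conv_lhs => rw [pdy]
    refine (congrArg (fun L : Vec n →L[ℝ] ℝ => L (Pi.single m 1)) h).trans ?_
    simp [pdy, mul_comm]
  simp only [hterm, Finset.sum_add_distrib, heuler]
  simp
  ring

end Spray

/-- `χ_k = −(1/3) T^m_{k·m}` where
`T^i_k := Rⁱ_k − (R δⁱ_k − (1/2) R_{·k} yⁱ)`. -/
theorem chi_eq_T_trace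
    {n : ℕ} (hn : 2 ≤ n) (U : Set (Vec n)) (hU : IsOpen U)
    (G : Fin n → Vec n → Vec n → ℝ) (hG : IsSpray U G) :
    ∀ x ∈ U, ∀ y : Vec n, y ≠ 0 → ∀ k,
      chi G k x y
        = -(1 / 3) * ∑ m, pdy (fun x' y' =>
            Riem2 G m k x' y'
              - (Rsc G x' y' * (if m = k then 1 else 0)
                  - (1 / 2) * pdy (Rsc G) k x' y' * y' m)) m x y := by
  intro x hx y hy k
  have hterm : ∀ m, pdy (fun x' y' => Riem2 G m k x' y'
        - (Rsc G x' y' * (if m = k then 1 else 0) - (1 / 2) * pdy (Rsc G) k x' y' * y' m)) m x y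
      = pdy (Riem2 G m k) m x y - (if m = k then pdy (Rsc G) m x y else 0)
        + (1 / 2) * pdy (fun x' y' => pdy (Rsc G) k x' y' * y' m) m x y := by
    intro m
    have hRiem := ((hG.smooth_Riem2 hU m k).differentiableAt_fiber hU hx hy).hasFDerivAt
    have hRsc := ((hG.smooth_Rsc hU).differentiableAt_fiber hU hx hy).hasFDerivAt
    have hmul := ((((hG.smooth_Rsc hU).pdy hU k).mul
      (.fiber_coord m)).differentiableAt_fiber hU hx hy).hasFDerivAt
    have h := ((hRiem.sub (hRsc.mul_const (if m = k then (1 : ℝ) else 0))).add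
      (hmul.const_mul (1 / 2))).fderiv
    have hfun : (fun y' => Riem2 G m k x y' - (Rsc G x y' * (if m = k then 1 else 0)
          - (1 / 2) * pdy (Rsc G) k x y' * y' m))
        = (fun y' => Riem2 G m k x y' - Rsc G x y' * (if m = k then 1 else 0)
          + (1 / 2) * (pdy (Rsc G) k x y' * y' m)) := by
      funext y'
      ring
    have h' := congrArg (fun L : Vec n →L[ℝ] ℝ => L (Pi.single m 1)) h
    conv_lhs => rw [pdy]
    rw [hfun]
    refine h'.trans ?_
    split_ifs <;> simp [pdy]
  simp only [hterm, Finset.sum_add_distrib, Finset.sum_sub_distrib, ← Finset.mul_sum,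
    hG.sum_pdy_Rsc_mul_coord hU hx hy k, Finset.sum_ite_eq', Finset.mem_univ, if_true]
  rw [chi, hG.sum_pdy_Riem2_diag hn hU hx hy k]
  ring
end
end

section
/- Let G be a spray on an open set U ⊆ ℝⁿ (n ≥ 2) and dV = σ(x) dx¹⋯dxⁿ a volume form on U with S-curvature S. Then the χ-curvature satisfies χ_k = (1/2)( S_{·k|m} y^m − S_{|k} ), where S_{|k} := ∂S/∂x^k − N^m_k ∂S/∂y^m and S_{·k|m} y^m := y^m ( ∂(S_{·k})/∂x^m − N^p_m ∂(S_{·k})/∂y^p ) − N^s_k S_{·s}, with S_{·k} := ∂S/∂y^k. In particular, this expression is independent of the choice of σ. -/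
open scoped BigOperators

noncomputable section

variable {n : ℕ}

open scoped ContDiff

/-- `f` is differentiable at `p`, with directional derivative `d` along `v`. -/
def HasDirDeriv {E : Type*} [NormedAddCommGroup E] [NormedSpace ℝ E]
    (f : E → ℝ) (p v : E) (d : ℝ) : Prop :=
  DifferentiableAt ℝ f p ∧ fderiv ℝ f p v = d

namespace HasDirDeriv

variable {E : Type*} [NormedAddCommGroup E] [NormedSpace ℝ E]
  {f g : E → ℝ} {p v : E} {a b : ℝ}

theorem add (hf : HasDirDeriv f p v a) (hg : HasDirDeriv g p v b) :
    HasDirDeriv (fun q => f q + g q) p v (a + b) :=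
  ⟨hf.1.add hg.1, by rw [fderiv_fun_add hf.1 hg.1, ← hf.2, ← hg.2]; rfl⟩

theorem sub (hf : HasDirDeriv f p v a) (hg : HasDirDeriv g p v b) :
    HasDirDeriv (fun q => f q - g q) p v (a - b) :=
  ⟨hf.1.sub hg.1, by rw [fderiv_fun_sub hf.1 hg.1, ← hf.2, ← hg.2]; rfl⟩

theorem mul (hf : HasDirDeriv f p v a) (hg : HasDirDeriv g p v b) :
    HasDirDeriv (fun q => f q * g q) p v (a * g p + f p * b) :=
  ⟨hf.1.mul hg.1, by
    rw [fderiv_fun_mul hf.1 hg.1, ← hf.2, ← hg.2]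
    simp only [_root_.add_apply, _root_.smul_apply, smul_eq_mul]
    ring⟩

theorem const_mul (c : ℝ) (hf : HasDirDeriv f p v a) :
    HasDirDeriv (fun q => c * f q) p v (c * a) :=
  ⟨hf.1.const_mul c, by rw [fderiv_const_mul hf.1, ← hf.2]; rfl⟩

theorem sum {ι : Type*} {s : Finset ι} {F : ι → E → ℝ} {d : ι → ℝ}
    (hF : ∀ i ∈ s, HasDirDeriv (F i) p v (d i)) :
    HasDirDeriv (fun q => ∑ i ∈ s, F i q) p v (∑ i ∈ s, d i) :=
  ⟨DifferentiableAt.fun_sum fun i hi => (hF i hi).1, by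
    rw [fderiv_fun_sum fun i hi => (hF i hi).1, _root_.sum_apply]
    exact Finset.sum_congr rfl fun i hi => (hF i hi).2⟩

theorem const (c : ℝ) (p v : E) : HasDirDeriv (fun _ : E => c) p v 0 :=
  ⟨differentiableAt_const c, by simp⟩

theorem coord {n : ℕ} (i k : Fin n) (y : Vec n) :
    HasDirDeriv (fun y' : Vec n => y' i) y (Pi.single k 1) (if i = k then 1 else 0) :=
  ⟨differentiableAt_apply i y, by
    rw [(hasFDerivAt_apply i y).fderiv]
    simp [Pi.single_apply]⟩

end HasDirDeriv

/-- The slit tangent bundle over `U`. -/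
def slit (U : Set (Vec n)) : Set (Vec n × Vec n) := U ×ˢ {y : Vec n | y ≠ 0}

theorem isOpen_slit {U : Set (Vec n)} (hU : IsOpen U) : IsOpen (slit U) :=
  hU.prod isOpen_ne

/-- Smoothness on the slit tangent bundle over `U`. -/
def SmoothOnSlit (U : Set (Vec n)) (F : Vec n → Vec n → ℝ) : Prop :=
  ContDiffOn ℝ ∞ (fun p : Vec n × Vec n => F p.1 p.2) (slit U)

namespace SmoothOnSlit

variable {U : Set (Vec n)} {F : Vec n → Vec n → ℝ} {x y : Vec n}

theorem contDiffAt (hF : SmoothOnSlit U F) (hU : IsOpen U) (hx : x ∈ U) (hy : y ≠ 0) :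
    ContDiffAt ℝ ∞ (fun p : Vec n × Vec n => F p.1 p.2) (x, y) :=
  ContDiffOn.contDiffAt hF ((isOpen_slit hU).mem_nhds ⟨hx, hy⟩)

theorem differentiableAt (hF : SmoothOnSlit U F) (hU : IsOpen U) (hx : x ∈ U) (hy : y ≠ 0) :
    DifferentiableAt ℝ (fun p : Vec n × Vec n => F p.1 p.2) (x, y) :=
  (hF.contDiffAt hU hx hy).differentiableAt (by simp)

theorem hasFDerivAt_left (hF : SmoothOnSlit U F) (hU : IsOpen U) (hx : x ∈ U) (hy : y ≠ 0) :
    HasFDerivAt (fun x' => F x' y)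
      ((fderiv ℝ (fun p : Vec n × Vec n => F p.1 p.2) (x, y)).comp
        (ContinuousLinearMap.inl ℝ (Vec n) (Vec n))) x :=
  HasFDerivAt.comp (g := fun p : Vec n × Vec n => F p.1 p.2) (f := fun x' => (x', y)) x
    (hF.differentiableAt hU hx hy).hasFDerivAt (hasFDerivAt_prodMk_left x y)

theorem hasFDerivAt_right (hF : SmoothOnSlit U F) (hU : IsOpen U) (hx : x ∈ U) (hy : y ≠ 0) :
    HasFDerivAt (fun y' => F x y')
      ((fderiv ℝ (fun p : Vec n × Vec n => F p.1 p.2) (x, y)).comp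
        (ContinuousLinearMap.inr ℝ (Vec n) (Vec n))) y :=
  HasFDerivAt.comp (g := fun p : Vec n × Vec n => F p.1 p.2) (f := fun y' => (x, y')) y
    (hF.differentiableAt hU hx hy).hasFDerivAt (hasFDerivAt_prodMk_right x y)

theorem hasDirDeriv_x (hF : SmoothOnSlit U F) (hU : IsOpen U) (hx : x ∈ U) (hy : y ≠ 0)
    (k : Fin n) : HasDirDeriv (fun x' => F x' y) x (Pi.single k 1) (pdx F k x y) :=
  ⟨(hF.hasFDerivAt_left hU hx hy).differentiableAt, rfl⟩

theorem hasDirDeriv_y (hF : SmoothOnSlit U F) (hU : IsOpen U) (hx : x ∈ U) (hy : y ≠ 0)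
    (k : Fin n) : HasDirDeriv (fun y' => F x y') y (Pi.single k 1) (pdy F k x y) :=
  ⟨(hF.hasFDerivAt_right hU hx hy).differentiableAt, rfl⟩

theorem pdx_eq (hF : SmoothOnSlit U F) (hU : IsOpen U) (hx : x ∈ U) (hy : y ≠ 0) (k : Fin n) :
    pdx F k x y =
      fderiv ℝ (fun p : Vec n × Vec n => F p.1 p.2) (x, y) (Pi.single k 1, 0) := by
  rw [pdx, (hF.hasFDerivAt_left hU hx hy).fderiv]
  rfl

theorem pdy_eq (hF : SmoothOnSlit U F) (hU : IsOpen U) (hx : x ∈ U) (hy : y ≠ 0) (k : Fin n) :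
    pdy F k x y =
      fderiv ℝ (fun p : Vec n × Vec n => F p.1 p.2) (x, y) (0, Pi.single k 1) := by
  rw [pdy, (hF.hasFDerivAt_right hU hx hy).fderiv]
  rfl

theorem contDiffOn_fderiv_apply (hF : SmoothOnSlit U F) (hU : IsOpen U) (v : Vec n × Vec n) :
    ContDiffOn ℝ ∞
      (fun q => fderiv ℝ (fun p : Vec n × Vec n => F p.1 p.2) q v) (slit U) :=
  (ContDiffOn.fderiv_of_isOpen hF (isOpen_slit hU) (m := ∞) (by simp)).clm_apply
    contDiffOn_const

theorem pdx (hF : SmoothOnSlit U F) (hU : IsOpen U) (k : Fin n) : SmoothOnSlit U (pdx F k) :=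
  (hF.contDiffOn_fderiv_apply hU (Pi.single k 1, 0)).congr
    fun _ hp => hF.pdx_eq hU hp.1 hp.2 k

theorem pdy (hF : SmoothOnSlit U F) (hU : IsOpen U) (k : Fin n) : SmoothOnSlit U (pdy F k) :=
  (hF.contDiffOn_fderiv_apply hU (0, Pi.single k 1)).congr
    fun _ hp => hF.pdy_eq hU hp.1 hp.2 k

theorem fderiv_fderiv_comm (hF : SmoothOnSlit U F) (hU : IsOpen U) (hx : x ∈ U) (hy : y ≠ 0)
    (v w : Vec n × Vec n) :
    fderiv ℝ (fun q => fderiv ℝ (fun p : Vec n × Vec n => F p.1 p.2) q v) (x, y) w =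
      fderiv ℝ (fun q => fderiv ℝ (fun p : Vec n × Vec n => F p.1 p.2) q w) (x, y) v := by
  have hc := hF.contDiffAt hU hx hy
  have hd : DifferentiableAt ℝ (fderiv ℝ fun p : Vec n × Vec n => F p.1 p.2) (x, y) :=
    (hc.fderiv_right (m := ∞) (by simp)).differentiableAt (by simp)
  have hs := hc.isSymmSndFDerivAt (by simpa using WithTop.coe_le_coe.2 (le_top : (2 : ℕ∞) ≤ ⊤)) v w
  rw [fderiv_clm_apply hd (differentiableAt_const v),
    fderiv_clm_apply hd (differentiableAt_const w)]
  simpa using hs.symm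

end SmoothOnSlit

section congr

variable {U : Set (Vec n)} {F H : Vec n → Vec n → ℝ} {x y : Vec n}

theorem pdx_congr (hU : IsOpen U) (h : ∀ x ∈ U, ∀ y, y ≠ 0 → F x y = H x y)
    (hx : x ∈ U) (hy : y ≠ 0) (k : Fin n) : pdx F k x y = pdx H k x y := by
  have : (fun x' => F x' y) =ᶠ[nhds x] fun x' => H x' y := by
    filter_upwards [hU.mem_nhds hx] with x' hx' using h x' hx' y hy
  rw [pdx, pdx, this.fderiv_eq]

theorem pdy_congr (h : ∀ x ∈ U, ∀ y, y ≠ 0 → F x y = H x y)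
    (hx : x ∈ U) (hy : y ≠ 0) (k : Fin n) : pdy F k x y = pdy H k x y := by
  have : (fun y' => F x y') =ᶠ[nhds y] fun y' => H x y' := by
    filter_upwards [isOpen_ne.mem_nhds hy] with y' hy' using h x hx y' hy'
  rw [pdy, pdy, this.fderiv_eq]

theorem fderiv_congr_slit {f g : Vec n × Vec n → ℝ} (hU : IsOpen U)
    (h : ∀ p ∈ slit U, f p = g p) (hx : x ∈ U) (hy : y ≠ 0) :
    fderiv ℝ f (x, y) = fderiv ℝ g (x, y) :=
  Filter.EventuallyEq.fderiv_eq <| by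
    filter_upwards [(isOpen_slit hU).mem_nhds ⟨hx, hy⟩] with p hp using h p hp

end congr

namespace SmoothOnSlit

variable {U : Set (Vec n)} {F : Vec n → Vec n → ℝ} {x y : Vec n}

theorem pdx_pdx_comm (hF : SmoothOnSlit U F) (hU : IsOpen U) (hx : x ∈ U) (hy : y ≠ 0)
    (j k : Fin n) : _root_.pdx (_root_.pdx F j) k x y = _root_.pdx (_root_.pdx F k) j x y := by
  rw [(hF.pdx hU j).pdx_eq hU hx hy, (hF.pdx hU k).pdx_eq hU hx hy,
    fderiv_congr_slit hU (fun p hp => hF.pdx_eq hU hp.1 hp.2 j) hx hy,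
    fderiv_congr_slit hU (fun p hp => hF.pdx_eq hU hp.1 hp.2 k) hx hy]
  exact hF.fderiv_fderiv_comm hU hx hy _ _

theorem pdy_pdy_comm (hF : SmoothOnSlit U F) (hU : IsOpen U) (hx : x ∈ U) (hy : y ≠ 0)
    (j k : Fin n) : _root_.pdy (_root_.pdy F j) k x y = _root_.pdy (_root_.pdy F k) j x y := by
  rw [(hF.pdy hU j).pdy_eq hU hx hy, (hF.pdy hU k).pdy_eq hU hx hy,
    fderiv_congr_slit hU (fun p hp => hF.pdy_eq hU hp.1 hp.2 j) hx hy,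
    fderiv_congr_slit hU (fun p hp => hF.pdy_eq hU hp.1 hp.2 k) hx hy]
  exact hF.fderiv_fderiv_comm hU hx hy _ _

theorem pdy_pdx_comm (hF : SmoothOnSlit U F) (hU : IsOpen U) (hx : x ∈ U) (hy : y ≠ 0)
    (j k : Fin n) : _root_.pdy (_root_.pdx F j) k x y = _root_.pdx (_root_.pdy F k) j x y := by
  rw [(hF.pdx hU j).pdy_eq hU hx hy, (hF.pdy hU k).pdx_eq hU hx hy,
    fderiv_congr_slit hU (fun p hp => hF.pdx_eq hU hp.1 hp.2 j) hx hy,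
    fderiv_congr_slit hU (fun p hp => hF.pdy_eq hU hp.1 hp.2 k) hx hy]
  exact hF.fderiv_fderiv_comm hU hx hy _ _

end SmoothOnSlit

namespace IsSpray

variable {U : Set (Vec n)} {G : Fin n → Vec n → Vec n → ℝ} {x y : Vec n}

theorem smooth (hG : IsSpray U G) (i : Fin n) : SmoothOnSlit U (G i) := hG.1 i

theorem smooth_Nc (hG : IsSpray U G) (hU : IsOpen U) (i j : Fin n) :
    SmoothOnSlit U (Nc G i j) := (hG.smooth i).pdy hU j

theorem smooth_Ga_s7 (hG : IsSpray U G) (hU : IsOpen U) (i j k : Fin n) :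
    SmoothOnSlit U (Ga G i j k) := (hG.smooth_Nc hU i j).pdy hU k

theorem Ga_symm (hG : IsSpray U G) (hU : IsOpen U) (hx : x ∈ U) (hy : y ≠ 0) (i j k : Fin n) :
    Ga G i j k x y = Ga G i k j x y :=
  (hG.smooth i).pdy_pdy_comm hU hx hy j k

theorem pdy_Ga_symm (hG : IsSpray U G) (hU : IsOpen U) (hx : x ∈ U) (hy : y ≠ 0)
    (i j k l : Fin n) : pdy (Ga G i j k) l x y = pdy (Ga G i k j) l x y :=
  pdy_congr (fun _ hx _ hy => hG.Ga_symm hU hx hy i j k) hx hy l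

theorem pdx_Ga_symm (hG : IsSpray U G) (hU : IsOpen U) (hx : x ∈ U) (hy : y ≠ 0)
    (i j k l : Fin n) : pdx (Ga G i j k) l x y = pdx (Ga G i k j) l x y :=
  pdx_congr hU (fun _ hx _ hy => hG.Ga_symm hU hx hy i j k) hx hy l

theorem pdy_Ga_comm (hG : IsSpray U G) (hU : IsOpen U) (hx : x ∈ U) (hy : y ≠ 0)
    (i j k l : Fin n) : pdy (Ga G i j k) l x y = pdy (Ga G i j l) k x y :=
  (hG.smooth_Nc hU i j).pdy_pdy_comm hU hx hy k l

theorem pdy_pdx_Nc (hG : IsSpray U G) (hU : IsOpen U) (hx : x ∈ U) (hy : y ≠ 0)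
    (i j k l : Fin n) : pdy (pdx (Nc G i j) k) l x y = pdx (Ga G i j l) k x y :=
  (hG.smooth_Nc hU i j).pdy_pdx_comm hU hx hy k l

theorem pdy_pdx (hG : IsSpray U G) (hU : IsOpen U) (hx : x ∈ U) (hy : y ≠ 0)
    (i k l : Fin n) : pdy (pdx (G i) k) l x y = pdx (Nc G i l) k x y :=
  (hG.smooth i).pdy_pdx_comm hU hx hy k l

/-- Euler's identity for `Gⁱ`. -/
theorem sum_mul_Nc (hG : IsSpray U G) (hU : IsOpen U) (hx : x ∈ U) (hy : y ≠ 0) (i : Fin n) :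
    ∑ j, y j * Nc G i j x y = 2 * G i x y := by
  have hf : HasFDerivAt (fun y' => G i x y') (fderiv ℝ (fun y' => G i x y') y)
      ((1 : ℝ) • y) := by
    rw [one_smul]
    exact ((hG.smooth i).hasFDerivAt_right hU hx hy).differentiableAt.hasFDerivAt
  have hl : HasDerivAt (fun t : ℝ => t • y) y 1 := by
    simpa using (hasDerivAt_id (1 : ℝ)).smul_const y
  have h₁ : HasDerivAt (fun t : ℝ => G i x (t • y)) (fderiv ℝ (fun y' => G i x y') y y) 1 :=
    hf.comp_hasDerivAt (1 : ℝ) hl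
  have h₂ : HasDerivAt (fun t : ℝ => G i x (t • y)) (2 * G i x y) 1 := by
    have h₃ : HasDerivAt (fun t : ℝ => t ^ 2 * G i x y) (2 * G i x y) 1 := by
      simpa using (hasDerivAt_pow 2 (1 : ℝ)).mul_const (G i x y)
    refine h₃.congr_of_eventuallyEq ?_
    filter_upwards [lt_mem_nhds (zero_lt_one' ℝ)] with t ht using hG.2 i x y t ht
  rw [← h₁.unique h₂]
  have h₄ := congrArg (fderiv ℝ (fun y' => G i x y') y) (pi_eq_sum_univ' y)
  simp only [map_sum, map_smul, smul_eq_mul] at h₄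
  exact h₄.symm

theorem sum_mul_Ga (hG : IsSpray U G) (hU : IsOpen U) (hx : x ∈ U) (hy : y ≠ 0) (i k : Fin n) :
    ∑ j, y j * Ga G i j k x y = Nc G i k x y := by
  have h := pdy_congr (F := fun x y => ∑ j, y j * Nc G i j x y) (H := fun x y => 2 * G i x y)
    (fun _ hx _ hy => hG.sum_mul_Nc hU hx hy i) hx hy k
  rw [pdy, pdy, (HasDirDeriv.sum fun j _ => (HasDirDeriv.coord j k y).mul
      ((hG.smooth_Nc hU i j).hasDirDeriv_y hU hx hy k)).2,
    (((hG.smooth i).hasDirDeriv_y hU hx hy k).const_mul 2).2, Finset.sum_add_distrib] at h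
  simp only [ite_mul, one_mul, zero_mul, Finset.sum_ite_eq', Finset.mem_univ, if_true] at h
  change Nc G i k x y + ∑ j, y j * Ga G i j k x y = 2 * Nc G i k x y at h
  linarith

theorem sum_mul_pdy_Ga (hG : IsSpray U G) (hU : IsOpen U) (hx : x ∈ U) (hy : y ≠ 0)
    (i k m : Fin n) : ∑ j, y j * pdy (Ga G i j k) m x y = 0 := by
  have h := pdy_congr (F := fun x y => ∑ j, y j * Ga G i j k x y) (H := Nc G i k)
    (fun _ hx _ hy => hG.sum_mul_Ga hU hx hy i k) hx hy m
  rw [pdy, (HasDirDeriv.sum fun j _ => (HasDirDeriv.coord j m y).mul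
      ((hG.smooth_Ga_s7 hU i j k).hasDirDeriv_y hU hx hy m)).2, Finset.sum_add_distrib] at h
  simp only [ite_mul, one_mul, zero_mul, Finset.sum_ite_eq', Finset.mem_univ, if_true] at h
  change _ = Ga G i k m x y at h
  rw [hG.Ga_symm hU hx hy i k m] at h
  linarith

theorem sum_mul_pdx_Nc (hG : IsSpray U G) (hU : IsOpen U) (hx : x ∈ U) (hy : y ≠ 0)
    (i k : Fin n) : ∑ j, y j * pdx (Nc G i j) k x y = 2 * pdx (G i) k x y := by
  have h := pdx_congr (F := fun x y => ∑ j, y j * Nc G i j x y) (H := fun x y => 2 * G i x y)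
    hU (fun _ hx _ hy => hG.sum_mul_Nc hU hx hy i) hx hy k
  rwa [pdx, pdx, (HasDirDeriv.sum fun j _ =>
      ((hG.smooth_Nc hU i j).hasDirDeriv_x hU hx hy k).const_mul (y j)).2,
    (((hG.smooth i).hasDirDeriv_x hU hx hy k).const_mul 2).2] at h

theorem sum_mul_pdx_Ga (hG : IsSpray U G) (hU : IsOpen U) (hx : x ∈ U) (hy : y ≠ 0)
    (i k l : Fin n) : ∑ j, y j * pdx (Ga G i j k) l x y = pdx (Nc G i k) l x y := by
  have h := pdx_congr (F := fun x y => ∑ j, y j * Ga G i j k x y) (H := Nc G i k)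
    hU (fun _ hx _ hy => hG.sum_mul_Ga hU hx hy i k) hx hy l
  rwa [pdx, (HasDirDeriv.sum fun j _ =>
      ((hG.smooth_Ga_s7 hU i j k).hasDirDeriv_x hU hx hy l).const_mul (y j)).2] at h

/-- The Riemann curvature in terms of the spray coefficients. -/
theorem Riem2_eq (hG : IsSpray U G) (hU : IsOpen U) (hx : x ∈ U) (hy : y ≠ 0) (i k : Fin n) :
    Riem2 G i k x y = 2 * pdx (G i) k x y - ∑ l, y l * pdx (Nc G i k) l x y
      + 2 * ∑ s, G s x y * Ga G i k s x y - ∑ s, Nc G s k x y * Nc G i s x y := by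
  have h₁ (l : Fin n) : ∑ j, y j * hd G (Ga G i j l) k x y = pdx (Nc G i l) k x y := by
    simp only [hd, mul_sub, Finset.sum_sub_distrib, hG.sum_mul_pdx_Ga hU hx hy, Finset.mul_sum]
    rw [Finset.sum_comm]
    simp only [mul_left_comm (y _), ← Finset.mul_sum, hG.sum_mul_pdy_Ga hU hx hy]
    simp
  have h₂ (l : Fin n) : ∑ j, y j * hd G (Ga G i j k) l x y = pdx (Nc G i k) l x y := by
    simp only [hd, mul_sub, Finset.sum_sub_distrib, hG.sum_mul_pdx_Ga hU hx hy, Finset.mul_sum]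
    rw [Finset.sum_comm]
    simp only [mul_left_comm (y _), ← Finset.mul_sum, hG.sum_mul_pdy_Ga hU hx hy]
    simp
  have h₃ (l : Fin n) : ∑ j, y j * ∑ s, Ga G i k s x y * Ga G s j l x y
      = ∑ s, Ga G i k s x y * Nc G s l x y := by
    simp only [Finset.mul_sum]
    rw [Finset.sum_comm]
    simp only [mul_left_comm (y _), ← Finset.mul_sum, hG.sum_mul_Ga hU hx hy]
  have h₄ (l : Fin n) : ∑ j, y j * ∑ s, Ga G s j k x y * Ga G i l s x y
      = ∑ s, Nc G s k x y * Ga G i l s x y := by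
    simp only [Finset.mul_sum]
    rw [Finset.sum_comm]
    simp only [← mul_assoc, ← Finset.sum_mul, hG.sum_mul_Ga hU hx hy]
  have h₅ (l : Fin n) : ∑ j, y j * Riem4 G j i k l x y = pdx (Nc G i l) k x y
      - pdx (Nc G i k) l x y + (∑ s, Ga G i k s x y * Nc G s l x y
      - ∑ s, Nc G s k x y * Ga G i l s x y) := by
    rw [← h₁, ← h₂, ← h₃, ← h₄]
    simp only [Riem4, mul_add, mul_sub, Finset.sum_add_distrib, Finset.sum_sub_distrib]
  have h₆ : ∑ l, y l * ∑ s, Ga G i k s x y * Nc G s l x y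
      = 2 * ∑ s, G s x y * Ga G i k s x y := by
    simp only [Finset.mul_sum]
    rw [Finset.sum_comm]
    simp only [mul_left_comm (y _), ← Finset.mul_sum, hG.sum_mul_Nc hU hx hy]
    rw [Finset.mul_sum]
    exact Finset.sum_congr rfl fun s _ => by ring
  have h₇ : ∑ l, y l * ∑ s, Nc G s k x y * Ga G i l s x y
      = ∑ s, Nc G s k x y * Nc G i s x y := by
    simp only [Finset.mul_sum]
    rw [Finset.sum_comm]
    simp only [mul_left_comm (y _), ← Finset.mul_sum, hG.sum_mul_Ga hU hx hy]
  rw [Riem2, Finset.sum_comm]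
  simp only [← Finset.sum_mul, h₅]
  simp only [mul_comm _ (y _), mul_sub, mul_add, Finset.sum_sub_distrib, Finset.sum_add_distrib,
    h₆, h₇, hG.sum_mul_pdx_Nc hU hx hy]
  ring

theorem pdy_Riem2 (hG : IsSpray U G) (hU : IsOpen U) (hx : x ∈ U) (hy : y ≠ 0)
    (i k p : Fin n) :
    pdy (Riem2 G i k) p x y = 2 * pdx (Nc G i p) k x y - pdx (Nc G i k) p x y
      - ∑ l, y l * pdx (Ga G i k p) l x y
      + 2 * (∑ s, Nc G s p x y * Ga G i k s x y + ∑ s, G s x y * pdy (Ga G i k s) p x y)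
      - (∑ s, Ga G s k p x y * Nc G i s x y + ∑ s, Nc G s k x y * Ga G i s p x y) := by
  rw [pdy_congr (fun _ hx _ hy => hG.Riem2_eq hU hx hy i k) hx hy p, pdy]
  rw [((((((hG.smooth i).pdx hU k).hasDirDeriv_y hU hx hy p).const_mul 2).sub
      (HasDirDeriv.sum fun l _ => (HasDirDeriv.coord l p y).mul
        (((hG.smooth_Nc hU i k).pdx hU l).hasDirDeriv_y hU hx hy p))).add
      ((HasDirDeriv.sum fun s _ => ((hG.smooth s).hasDirDeriv_y hU hx hy p).mul
        ((hG.smooth_Ga_s7 hU i k s).hasDirDeriv_y hU hx hy p)).const_mul 2)).sub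
      (HasDirDeriv.sum fun s _ => ((hG.smooth_Nc hU s k).hasDirDeriv_y hU hx hy p).mul
        ((hG.smooth_Nc hU i s).hasDirDeriv_y hU hx hy p)) |>.2]
  simp only [Finset.sum_add_distrib, ite_mul, one_mul, zero_mul, Finset.sum_ite_eq',
    Finset.mem_univ, if_true, hG.pdy_pdx_Nc hU hx hy, hG.pdy_pdx hU hx hy]
  simp only [Nc, Ga]
  ring

/-- The `χ`-curvature in terms of the contracted spray coefficients. -/
theorem chi_eq (hG : IsSpray U G) (hU : IsOpen U) (hx : x ∈ U) (hy : y ≠ 0) (k : Fin n) :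
    chi G k x y = (1 / 2) * (∑ m, ∑ l, y l * pdx (Ga G m m k) l x y
      - 2 * ∑ m, ∑ s, G s x y * pdy (Ga G m m k) s x y - ∑ m, pdx (Nc G m m) k x y) := by
  have e₁ (m l : Fin n) : pdx (Ga G m k m) l x y = pdx (Ga G m m k) l x y :=
    hG.pdx_Ga_symm hU hx hy m k m l
  have e₂ (m s : Fin n) : pdy (Ga G m k s) m x y = pdy (Ga G m m k) s x y := by
    rw [hG.pdy_Ga_comm hU hx hy, hG.pdy_Ga_symm hU hx hy]
  have e₃ (m s : Fin n) : pdy (Ga G m m s) k x y = pdy (Ga G m m k) s x y :=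
    hG.pdy_Ga_comm hU hx hy m m s k
  have c₁ : ∑ m, ∑ s, Nc G s m x y * Ga G m k s x y
      = ∑ m, ∑ s, Ga G s k m x y * Nc G m s x y := by
    rw [Finset.sum_comm]
    simp only [mul_comm]
  have c₂ : ∑ m, ∑ s, Ga G s m k x y * Nc G m s x y
      = ∑ m, ∑ s, Ga G s k m x y * Nc G m s x y := by
    simp only [fun m s : Fin n => hG.Ga_symm hU hx hy s m k]
  have c₃ : ∑ m, ∑ s, Nc G s m x y * Ga G m s k x y
      = ∑ m, ∑ s, Ga G s k m x y * Nc G m s x y := by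
    rw [← c₁]
    simp only [fun m s : Fin n => hG.Ga_symm hU hx hy m s k]
  have c₄ : ∑ m, ∑ s, Nc G s k x y * Ga G m s m x y
      = ∑ m, ∑ s, Nc G s k x y * Ga G m m s x y := by
    simp only [fun m s : Fin n => hG.Ga_symm hU hx hy m s m]
  simp only [chi, hG.pdy_Riem2 hU hx hy, Finset.sum_sub_distrib, Finset.sum_add_distrib,
    ← Finset.mul_sum (s := Finset.univ) (a := (2 : ℝ)), e₁, e₂, e₃, c₁, c₂, c₃, c₄]
  ring

end IsSpray

section volume

variable {U : Set (Vec n)} {G : Fin n → Vec n → Vec n → ℝ} {σ : Vec n → ℝ} {x y : Vec n}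

theorem IsVolumeForm.smooth_log (hσ : IsVolumeForm U σ) :
    SmoothOnSlit U fun x _ => Real.log (σ x) :=
  ContDiffOn.comp (g := fun x => Real.log (σ x)) (t := U)
    (hσ.1.log fun x hx => (hσ.2 x hx).ne') contDiffOn_fst fun _ hp => hp.1

theorem pd_log_eq (σ : Vec n → ℝ) (m : Fin n) (x y : Vec n) :
    pd (fun x' => Real.log (σ x')) m x = pdx (fun x _ => Real.log (σ x)) m x y := rfl

theorem pdy_Scurv (hU : IsOpen U) (hG : IsSpray U G) (hx : x ∈ U) (hy : y ≠ 0) (k : Fin n) :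
    pdy (Scurv G σ) k x y
      = ∑ m, Ga G m m k x y - pdx (fun x _ => Real.log (σ x)) k x y := by
  change fderiv ℝ (fun y' => (∑ m, Nc G m m x y')
    - ∑ m, y' m * pd (fun x' => Real.log (σ x')) m x) y (Pi.single k 1) = _
  rw [((HasDirDeriv.sum fun m _ => (hG.smooth_Nc hU m m).hasDirDeriv_y hU hx hy k).sub
    (HasDirDeriv.sum fun m _ => (HasDirDeriv.coord m k y).mul
      (HasDirDeriv.const (pd (fun x' => Real.log (σ x')) m x) y _))).2]
  simp [Ga, pd_log_eq σ k x y]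

theorem pdx_Scurv (hU : IsOpen U) (hG : IsSpray U G) (hσ : IsVolumeForm U σ) (hx : x ∈ U)
    (hy : y ≠ 0) (k : Fin n) :
    pdx (Scurv G σ) k x y = ∑ m, pdx (Nc G m m) k x y
      - ∑ m, y m * pdx (pdx (fun x _ => Real.log (σ x)) m) k x y :=
  ((HasDirDeriv.sum fun m _ => (hG.smooth_Nc hU m m).hasDirDeriv_x hU hx hy k).sub
    (HasDirDeriv.sum fun m _ =>
      ((hσ.smooth_log.pdx hU m).hasDirDeriv_x hU hx hy k).const_mul (y m))).2

theorem pdx_pdy_Scurv (hU : IsOpen U) (hG : IsSpray U G) (hσ : IsVolumeForm U σ) (hx : x ∈ U)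
    (hy : y ≠ 0) (k l : Fin n) :
    pdx (pdy (Scurv G σ) k) l x y = ∑ m, pdx (Ga G m m k) l x y
      - pdx (pdx (fun x _ => Real.log (σ x)) k) l x y := by
  rw [pdx_congr hU (fun _ hx _ hy => pdy_Scurv hU hG hx hy k) hx hy l]
  exact ((HasDirDeriv.sum fun m _ => (hG.smooth_Ga_s7 hU m m k).hasDirDeriv_x hU hx hy l).sub
    ((hσ.smooth_log.pdx hU k).hasDirDeriv_x hU hx hy l)).2

theorem pdy_pdy_Scurv (hU : IsOpen U) (hG : IsSpray U G) (hx : x ∈ U)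
    (hy : y ≠ 0) (k l : Fin n) :
    pdy (pdy (Scurv G σ) k) l x y = ∑ m, pdy (Ga G m m k) l x y := by
  rw [pdy_congr (fun _ hx _ hy => pdy_Scurv hU hG hx hy k) hx hy l]
  refine (((HasDirDeriv.sum fun m _ => (hG.smooth_Ga_s7 hU m m k).hasDirDeriv_y hU hx hy l).sub
    (HasDirDeriv.const (pd (fun x' => Real.log (σ x')) k x) y _)).2).trans ?_
  rw [sub_zero]

end volume

/-- `χ_k = (1/2)(S_{·k|m} y^m − S_{|k})`, where `S` is the S-curvature of
`(G, dV)`; in particular the right-hand side is independent of the density `σ`. -/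
theorem chi_eq_S_formula
    {n : ℕ} (hn : 2 ≤ n) (U : Set (Vec n)) (hU : IsOpen U)
    (G : Fin n → Vec n → Vec n → ℝ) (hG : IsSpray U G)
    (σ : Vec n → ℝ) (hσ : IsVolumeForm U σ) :
    ∀ x ∈ U, ∀ y : Vec n, y ≠ 0 → ∀ k,
      chi G k x y
        = (1 / 2) *
            ((∑ m, y m * hd G (fun x' y' => pdy (Scurv G σ) k x' y') m x y
                - ∑ s, Nc G s k x y * pdy (Scurv G σ) s x y)
              - hd G (Scurv G σ) k x y) := by
  intro x hx y hy k
  have h₁ : ∑ m, y m * ∑ p, Nc G p m x y * pdy (pdy (Scurv G σ) k) p x y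
      = 2 * ∑ m, ∑ s, G s x y * pdy (Ga G m m k) s x y := by
    simp only [Finset.mul_sum]
    rw [Finset.sum_comm]
    simp only [← mul_assoc, ← Finset.sum_mul, hG.sum_mul_Nc hU hx hy, pdy_pdy_Scurv hU hG hx hy]
    simp only [Finset.mul_sum]
    rw [Finset.sum_comm]
  have h₂ : ∑ m, y m * pdx (pdy (Scurv G σ) k) m x y
      = ∑ m, ∑ l, y l * pdx (Ga G m m k) l x y
        - ∑ m, y m * pdx (pdx (fun x _ => Real.log (σ x)) m) k x y := by
    simp only [pdx_pdy_Scurv hU hG hσ hx hy, mul_sub, Finset.sum_sub_distrib, Finset.mul_sum]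
    rw [Finset.sum_comm]
    simp only [fun m => hσ.smooth_log.pdx_pdx_comm hU hx hy k m]
  rw [hG.chi_eq hU hx hy]
  simp only [hd, mul_sub, Finset.sum_sub_distrib]
  change _ = 1 / 2 * (∑ m, y m * pdx (pdy (Scurv G σ) k) m x y)
    - 1 / 2 * (∑ m, y m * ∑ p, Nc G p m x y * pdy (pdy (Scurv G σ) k) p x y) - _ - _
  rw [h₁, h₂, pdx_Scurv hU hG hσ hx hy]
  ring
end
end

section
/- For any spray G on an open set U ⊆ ℝⁿ (n ≥ 2), with Π := ∂G^m/∂y^m, the χ-curvature is given in local coordinates by χ_k = (1/2)( (∂²Π/∂x^m∂y^k) y^m − ∂Π/∂x^k − 2 (∂²Π/∂y^k∂y^m) G^m ). -/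
open scoped BigOperators

noncomputable section

variable {n : ℕ}

/-- `f` is smooth on `W`, as a function of both arguments. -/
def JointlySmooth (W : Set (Vec n × Vec n)) (f : Vec n → Vec n → ℝ) : Prop :=
  ContDiffOn ℝ (⊤ : ℕ∞) (fun p : Vec n × Vec n => f p.1 p.2) W

section Calculus

variable {W : Set (Vec n × Vec n)} {f g : Vec n → Vec n → ℝ} {x y : Vec n}

lemma JointlySmooth.contDiffAt (hf : JointlySmooth W f) (hW : IsOpen W) (h : (x, y) ∈ W) :
    ContDiffAt ℝ (⊤ : ℕ∞) (fun p : Vec n × Vec n => f p.1 p.2) (x, y) :=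
  ContDiffOn.contDiffAt hf (hW.mem_nhds h)

lemma JointlySmooth.hasFDerivAt (hf : JointlySmooth W f) (hW : IsOpen W) (h : (x, y) ∈ W) :
    HasFDerivAt (fun p : Vec n × Vec n => f p.1 p.2)
      (fderiv ℝ (fun p : Vec n × Vec n => f p.1 p.2) (x, y)) (x, y) :=
  ((hf.contDiffAt hW h).differentiableAt (by simp)).hasFDerivAt

lemma JointlySmooth.hasFDerivAt_fst (hf : JointlySmooth W f) (hW : IsOpen W) (h : (x, y) ∈ W) :
    HasFDerivAt (fun x' => f x' y) (fderiv ℝ (fun x' => f x' y) x) x :=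
  ((hf.hasFDerivAt hW h).comp (f := fun x' => (x', y)) x
    ((hasFDerivAt_id x).prodMk (hasFDerivAt_const y x))).differentiableAt.hasFDerivAt

lemma JointlySmooth.hasFDerivAt_snd (hf : JointlySmooth W f) (hW : IsOpen W) (h : (x, y) ∈ W) :
    HasFDerivAt (fun y' => f x y') (fderiv ℝ (fun y' => f x y') y) y :=
  ((hf.hasFDerivAt hW h).comp (f := fun y' => (x, y')) y
    ((hasFDerivAt_const x y).prodMk (hasFDerivAt_id y))).differentiableAt.hasFDerivAt

lemma JointlySmooth.pdx_eq (hf : JointlySmooth W f) (hW : IsOpen W) (h : (x, y) ∈ W)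
    (k : Fin n) :
    pdx f k x y = fderiv ℝ (fun p : Vec n × Vec n => f p.1 p.2) (x, y) (Pi.single k 1, 0) := by
  have := (hf.hasFDerivAt hW h).comp (f := fun x' => (x', y)) x
    ((hasFDerivAt_id x).prodMk (hasFDerivAt_const y x))
  exact congrArg (· (Pi.single k 1)) this.fderiv

lemma JointlySmooth.pdy_eq (hf : JointlySmooth W f) (hW : IsOpen W) (h : (x, y) ∈ W)
    (k : Fin n) :
    pdy f k x y = fderiv ℝ (fun p : Vec n × Vec n => f p.1 p.2) (x, y) (0, Pi.single k 1) := by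
  have := (hf.hasFDerivAt hW h).comp (f := fun y' => (x, y')) y
    ((hasFDerivAt_const x y).prodMk (hasFDerivAt_id y))
  exact congrArg (· (Pi.single k 1)) this.fderiv

lemma JointlySmooth.fderiv_apply (hf : JointlySmooth W f) (hW : IsOpen W) (v : Vec n × Vec n) :
    JointlySmooth W fun x y => fderiv ℝ (fun p : Vec n × Vec n => f p.1 p.2) (x, y) v :=
  (ContDiffOn.fderiv_of_isOpen hf hW (m := (⊤ : ℕ∞)) le_rfl).clm_apply contDiffOn_const

lemma JointlySmooth.pdx (hf : JointlySmooth W f) (hW : IsOpen W) (k : Fin n) :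
    JointlySmooth W (pdx f k) :=
  ContDiffOn.congr (hf.fderiv_apply hW (Pi.single k 1, 0)) fun _ hp => hf.pdx_eq hW hp k

lemma JointlySmooth.pdy (hf : JointlySmooth W f) (hW : IsOpen W) (k : Fin n) :
    JointlySmooth W (pdy f k) :=
  ContDiffOn.congr (hf.fderiv_apply hW (0, Pi.single k 1)) fun _ hp => hf.pdy_eq hW hp k

lemma JointlySmooth.hasDerivAt_pdx (hf : JointlySmooth W f) (hW : IsOpen W) (h : (x, y) ∈ W)
    (k : Fin n) :
    HasDerivAt (fun t : ℝ => f (x + t • Pi.single k 1) y) (_root_.pdx f k x y) 0 :=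
  (hf.hasFDerivAt_fst hW h).hasLineDerivAt _

lemma JointlySmooth.hasDerivAt_pdy (hf : JointlySmooth W f) (hW : IsOpen W) (h : (x, y) ∈ W)
    (k : Fin n) :
    HasDerivAt (fun t : ℝ => f x (y + t • Pi.single k 1)) (_root_.pdy f k x y) 0 :=
  (hf.hasFDerivAt_snd hW h).hasLineDerivAt _

lemma pdx_congr_s8 (hW : IsOpen W) (hfg : ∀ x y, (x, y) ∈ W → f x y = g x y) (h : (x, y) ∈ W)
    (k : Fin n) : pdx f k x y = pdx g k x y := by
  have hm : ∀ᶠ x' in nhds x, (x', y) ∈ W :=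
    (Continuous.prodMk_left y).continuousAt.preimage_mem_nhds (hW.mem_nhds h)
  have : (fun x' => f x' y) =ᶠ[nhds x] fun x' => g x' y := hm.mono fun x' => hfg x' y
  simp only [pdx, this.fderiv_eq]

lemma pdy_congr_s8 (hW : IsOpen W) (hfg : ∀ x y, (x, y) ∈ W → f x y = g x y) (h : (x, y) ∈ W)
    (k : Fin n) : pdy f k x y = pdy g k x y := by
  have hm : ∀ᶠ y' in nhds y, (x, y') ∈ W :=
    (Continuous.prodMk_right x).continuousAt.preimage_mem_nhds (hW.mem_nhds h)
  have : (fun y' => f x y') =ᶠ[nhds y] fun y' => g x y' := hm.mono fun y' => hfg x y'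
  simp only [pdy, this.fderiv_eq]

lemma JointlySmooth.fderiv_fderiv_comm (hf : JointlySmooth W f) (hW : IsOpen W)
    (h : (x, y) ∈ W) (v w : Vec n × Vec n) :
    fderiv ℝ (fun q : Vec n × Vec n =>
        fderiv ℝ (fun p : Vec n × Vec n => f p.1 p.2) (q.1, q.2) v) (x, y) w
      = fderiv ℝ (fun q : Vec n × Vec n =>
        fderiv ℝ (fun p : Vec n × Vec n => f p.1 p.2) (q.1, q.2) w) (x, y) v := by
  have hd : DifferentiableAt ℝ (fderiv ℝ fun p : Vec n × Vec n => f p.1 p.2) (x, y) :=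
    ((hf.contDiffAt hW h).fderiv_right (m := (⊤ : ℕ∞)) le_rfl).differentiableAt (by simp)
  have key (u : Vec n × Vec n) : fderiv ℝ (fun q : Vec n × Vec n =>
      fderiv ℝ (fun p : Vec n × Vec n => f p.1 p.2) (q.1, q.2) u) (x, y)
      = (fderiv ℝ (fderiv ℝ fun p : Vec n × Vec n => f p.1 p.2) (x, y)).flip u := by
    simpa using fderiv_clm_apply hd (differentiableAt_const u)
  rw [key, key]
  exact (hf.contDiffAt hW h).isSymmSndFDerivAt
    (by simpa using WithTop.coe_le_coe.2 (le_top : (2 : ℕ∞) ≤ ⊤)) w v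

lemma JointlySmooth.pdy_pdy_comm (hf : JointlySmooth W f) (hW : IsOpen W) (h : (x, y) ∈ W)
    (j k : Fin n) : _root_.pdy (_root_.pdy f j) k x y = _root_.pdy (_root_.pdy f k) j x y := by
  rw [pdy_congr_s8 hW (fun x y h => hf.pdy_eq hW h j) h,
    pdy_congr_s8 hW (fun x y h => hf.pdy_eq hW h k) h,
    (hf.fderiv_apply hW _).pdy_eq hW h, (hf.fderiv_apply hW _).pdy_eq hW h]
  exact hf.fderiv_fderiv_comm hW h _ _

lemma JointlySmooth.pdy_pdx_comm (hf : JointlySmooth W f) (hW : IsOpen W) (h : (x, y) ∈ W)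
    (j k : Fin n) : _root_.pdy (_root_.pdx f j) k x y = _root_.pdx (_root_.pdy f k) j x y := by
  rw [pdy_congr_s8 hW (fun x y h => hf.pdx_eq hW h j) h,
    pdx_congr_s8 hW (fun x y h => hf.pdy_eq hW h k) h,
    (hf.fderiv_apply hW _).pdy_eq hW h, (hf.fderiv_apply hW _).pdx_eq hW h]
  exact hf.fderiv_fderiv_comm hW h _ _

lemma JointlySmooth.sum {ι : Type*} {s : Finset ι} {F : ι → Vec n → Vec n → ℝ}
    (hF : ∀ i ∈ s, JointlySmooth W (F i)) : JointlySmooth W fun x y => ∑ i ∈ s, F i x y :=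
  ContDiffOn.sum hF

lemma pdx_sum {ι : Type*} {s : Finset ι} {F : ι → Vec n → Vec n → ℝ}
    (hF : ∀ i ∈ s, JointlySmooth W (F i)) (hW : IsOpen W) (h : (x, y) ∈ W) (k : Fin n) :
    pdx (fun x y => ∑ i ∈ s, F i x y) k x y = ∑ i ∈ s, pdx (F i) k x y :=
  ((JointlySmooth.sum hF).hasDerivAt_pdx hW h k).unique
    (HasDerivAt.fun_sum fun i hi => (hF i hi).hasDerivAt_pdx hW h k)

lemma pdy_sum {ι : Type*} {s : Finset ι} {F : ι → Vec n → Vec n → ℝ}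
    (hF : ∀ i ∈ s, JointlySmooth W (F i)) (hW : IsOpen W) (h : (x, y) ∈ W) (k : Fin n) :
    pdy (fun x y => ∑ i ∈ s, F i x y) k x y = ∑ i ∈ s, pdy (F i) k x y :=
  ((JointlySmooth.sum hF).hasDerivAt_pdy hW h k).unique
    (HasDerivAt.fun_sum fun i hi => (hF i hi).hasDerivAt_pdy hW h k)

lemma jointlySmooth_coord (l : Fin n) : JointlySmooth W fun _ y => y l :=
  ((contDiff_apply ℝ ℝ l).comp contDiff_snd).contDiffOn

lemma hasDerivAt_coord (y : Vec n) (l k : Fin n) :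
    HasDerivAt (fun t : ℝ => (y + t • Pi.single k 1 : Vec n) l) ((Pi.single k 1 : Vec n) l) 0 := by
  simpa using ((hasDerivAt_id (0 : ℝ)).mul_const ((Pi.single k 1 : Vec n) l)).const_add (y l)

/-- The infinitesimal form of positive homogeneity of degree `c` in `y`, on `W`. -/
def EulerOn (W : Set (Vec n × Vec n)) (c : ℝ) (f : Vec n → Vec n → ℝ) : Prop :=
  ∀ x y, (x, y) ∈ W → ∑ m, y m * pdy f m x y = c * f x y

lemma EulerOn.pdy {c : ℝ} (he : EulerOn W c f) (hf : JointlySmooth W f) (hW : IsOpen W)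
    (j : Fin n) : EulerOn W (c - 1) (pdy f j) := by
  intro x y h
  have h1 : HasDerivAt
      (fun t : ℝ => ∑ m, (y + t • Pi.single j 1 : Vec n) m
        * _root_.pdy f m x (y + t • Pi.single j 1))
      (∑ m, ((Pi.single j 1 : Vec n) m * _root_.pdy f m x y
        + y m * _root_.pdy (_root_.pdy f m) j x y)) 0 := by
    refine HasDerivAt.fun_sum fun m _ => ?_
    simpa using (hasDerivAt_coord y m j).fun_mul ((hf.pdy hW m).hasDerivAt_pdy hW h j)
  have h2 := (hf.hasDerivAt_pdy hW h j).const_mul c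
  have hm : ∀ᶠ t : ℝ in nhds 0, (x, y + t • Pi.single j 1) ∈ W := by
    have hc : Continuous fun t : ℝ => (x, y + t • (Pi.single j 1 : Vec n)) := by fun_prop
    exact hc.continuousAt.preimage_mem_nhds (hW.mem_nhds (by simpa using h))
  have h3 := h1.unique (h2.congr_of_eventuallyEq (hm.mono fun t => he x _))
  simp only [Finset.sum_add_distrib, Pi.single_apply, ite_mul, one_mul, zero_mul,
    Finset.sum_ite_eq', Finset.mem_univ, if_true] at h3
  have h4 : ∑ m, y m * _root_.pdy (_root_.pdy f j) m x y
      = ∑ m, y m * _root_.pdy (_root_.pdy f m) j x y :=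
    Finset.sum_congr rfl fun m _ => by rw [hf.pdy_pdy_comm hW h]
  linarith

lemma EulerOn.sum_mul_pdx_pdy {c : ℝ} (he : EulerOn W c f) (hf : JointlySmooth W f)
    (hW : IsOpen W) (h : (x, y) ∈ W) (j : Fin n) :
    ∑ m, y m * pdx (_root_.pdy f m) j x y = c * pdx f j x y := by
  have h1 : HasDerivAt
      (fun t : ℝ => ∑ m, y m * _root_.pdy f m (x + t • Pi.single j 1) y)
      (∑ m, y m * _root_.pdx (_root_.pdy f m) j x y) 0 :=
    HasDerivAt.fun_sum fun m _ => ((hf.pdy hW m).hasDerivAt_pdx hW h j).const_mul (y m)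
  have h2 := (hf.hasDerivAt_pdx hW h j).const_mul c
  have hm : ∀ᶠ t : ℝ in nhds 0, (x + t • Pi.single j 1, y) ∈ W := by
    have hc : Continuous fun t : ℝ => (x + t • (Pi.single j 1 : Vec n), y) := by fun_prop
    exact hc.continuousAt.preimage_mem_nhds (hW.mem_nhds (by simpa using h))
  exact h1.unique (h2.congr_of_eventuallyEq (hm.mono fun t => he _ y))

/-- The Euler theorem on positively homogeneous functions. -/
lemma eulerOn_of_homogeneous (hf : JointlySmooth W f) (hW : IsOpen W) (d : ℕ)
    (hom : ∀ (x y : Vec n) (lam : ℝ), 0 < lam → f x (lam • y) = lam ^ d * f x y) :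
    EulerOn W d f := by
  intro x y h
  have h1 : HasDerivAt (fun t : ℝ => f x (t • y)) (fderiv ℝ (fun y' => f x y') y y) 1 := by
    have hl : HasDerivAt (fun t : ℝ => t • y) y 1 := by
      simpa using (hasDerivAt_id (1 : ℝ)).smul_const y
    refine HasFDerivAt.comp_hasDerivAt (1 : ℝ) (l := fun y' => f x y') ?_ hl
    simpa using hf.hasFDerivAt_snd hW h
  have h2 : HasDerivAt (fun t : ℝ => t ^ d * f x y) (d * f x y) 1 := by
    simpa using (hasDerivAt_pow d (1 : ℝ)).mul_const (f x y)
  have h3 : (fun t : ℝ => f x (t • y)) =ᶠ[nhds 1] fun t => t ^ d * f x y :=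
    (lt_mem_nhds zero_lt_one).mono fun t ht => hom x y t ht
  rw [← h1.unique (h2.congr_of_eventuallyEq h3)]
  generalize hL : fderiv ℝ (fun y' => f x y') y = L
  rw [pi_eq_sum_univ' y, map_sum]
  simp only [map_smul, smul_eq_mul, pdy, ← pi_eq_sum_univ' y, hL]

end Calculus

section Contraction

variable {ι κ : Type*} [Fintype ι] [Fintype κ]

lemma sum_sum_mul_mul (y : ι → ℝ) (P : ι → ι → ℝ) :
    ∑ j, ∑ l, y j * P j l * y l = ∑ j, y j * ∑ l, y l * P j l := by
  simp only [Finset.mul_sum]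
  exact Finset.sum_congr rfl fun j _ => Finset.sum_congr rfl fun l _ => by ring

lemma sum_sum_mul_mul' (y : ι → ℝ) (P : ι → ι → ℝ) :
    ∑ j, ∑ l, y j * P j l * y l = ∑ l, y l * ∑ j, y j * P j l := by
  rw [Finset.sum_comm]
  simp only [Finset.mul_sum]
  exact Finset.sum_congr rfl fun j _ => Finset.sum_congr rfl fun l _ => by ring

lemma sum_mul_sum_mul_comm (y : ι → ℝ) (b : κ → ℝ) (Q : ι → κ → ℝ) :
    ∑ l, y l * ∑ m, b m * Q l m = ∑ m, b m * ∑ l, y l * Q l m := by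
  simp only [Finset.mul_sum]
  rw [Finset.sum_comm]
  exact Finset.sum_congr rfl fun j _ => Finset.sum_congr rfl fun l _ => by ring

end Contraction

section Spray

variable {W : Set (Vec n × Vec n)} {G : Fin n → Vec n → Vec n → ℝ} {x y : Vec n}

lemma jointlySmooth_Nc (hW : IsOpen W) (hG : ∀ i, JointlySmooth W (G i)) (i j : Fin n) :
    JointlySmooth W (Nc G i j) :=
  (hG i).pdy hW j

lemma jointlySmooth_Ga (hW : IsOpen W) (hG : ∀ i, JointlySmooth W (G i)) (i j k : Fin n) :
    JointlySmooth W (Ga G i j k) :=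
  (jointlySmooth_Nc hW hG i j).pdy hW k

lemma pdy_eq_Nc (i j : Fin n) : pdy (G i) j = Nc G i j := rfl

lemma pdy_Nc (i j k : Fin n) : pdy (Nc G i j) k = Ga G i j k := rfl

lemma Ga_symm (hW : IsOpen W) (hG : ∀ i, JointlySmooth W (G i)) (h : (x, y) ∈ W)
    (i j k : Fin n) : Ga G i j k x y = Ga G i k j x y :=
  (hG i).pdy_pdy_comm hW h j k

/-- The expression of the Riemann curvature `Rⁱ_k` in terms of the spray coefficients. -/
lemma Riem2_eq (hW : IsOpen W) (hG : ∀ i, JointlySmooth W (G i)) (he : ∀ i, EulerOn W 2 (G i))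
    (h : (x, y) ∈ W) (i k : Fin n) :
    Riem2 G i k x y = 2 * pdx (G i) k x y - ∑ l, y l * pdx (Nc G i k) l x y
      + 2 * ∑ s, Ga G i k s x y * G s x y - ∑ s, Nc G i s x y * Nc G s k x y := by
  have hN := jointlySmooth_Nc hW hG
  have eN (i j) : EulerOn W 1 (Nc G i j) := by
    have := (he i).pdy (hG i) hW j
    norm_num at this
    exact this
  have eΓ (i j k) : EulerOn W 0 (Ga G i j k) := by
    have := (eN i j).pdy (hN i j) hW k
    norm_num at this
    exact this
  have cG (i) : ∑ j, y j * Nc G i j x y = 2 * G i x y := he i x y h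
  have cN (i j) : ∑ l, y l * Ga G i j l x y = Nc G i j x y := by
    simpa [pdy_Nc] using eN i j x y h
  have cN' (i j) : ∑ l, y l * Ga G i l j x y = Nc G i j x y := by
    simpa only [Ga_symm hW hG h i j] using cN i j
  have cxG (k) : ∑ j, y j * pdx (Nc G i j) k x y = 2 * pdx (G i) k x y :=
    (he i).sum_mul_pdx_pdy (hG i) hW h k
  have cxN (j k) : ∑ l, y l * pdx (Ga G i j l) k x y = pdx (Nc G i j) k x y := by
    simpa [pdy_Nc] using (eN i j).sum_mul_pdx_pdy (hN i j) hW h k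
  have cxN' (j k) : ∑ l, y l * pdx (Ga G i l j) k x y = pdx (Nc G i j) k x y := by
    rw [← cxN]
    exact Finset.sum_congr rfl fun l _ => by
      rw [pdx_congr_s8 hW (fun x y h => Ga_symm hW hG h i l j) h]
  have cΓ (j m) : ∑ l, y l * pdy (Ga G i j l) m x y = 0 := by
    refine (Finset.sum_congr rfl fun l _ => ?_).trans ((eΓ i j m x y h).trans (zero_mul _))
    rw [← pdy_Nc, (hN i j).pdy_pdy_comm hW h, pdy_Nc]
  have cΓ' (j m) : ∑ l, y l * pdy (Ga G i l j) m x y = 0 := by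
    rw [← cΓ j m]
    exact Finset.sum_congr rfl fun l _ => by
      rw [pdy_congr_s8 hW (fun x y h => Ga_symm hW hG h i l j) h]
  have split : Riem2 G i k x y
      = ∑ j, ∑ l, y j * pdx (Ga G i j l) k x y * y l
        - ∑ j, ∑ l, y j * (∑ m, Nc G m k x y * pdy (Ga G i j l) m x y) * y l
        - ∑ j, ∑ l, y j * pdx (Ga G i j k) l x y * y l
        + ∑ j, ∑ l, y j * (∑ m, Nc G m l x y * pdy (Ga G i j k) m x y) * y l
        + ∑ j, ∑ l, y j * (∑ s, Ga G i k s x y * Ga G s j l x y) * y l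
        - ∑ j, ∑ l, y j * (∑ s, Ga G s j k x y * Ga G i l s x y) * y l := by
    simp only [Riem2, Riem4, hd, mul_sub, mul_add, sub_mul, add_mul, Finset.sum_sub_distrib,
      Finset.sum_add_distrib]
    ring
  rw [split, sum_sum_mul_mul y fun j l => pdx (Ga G i j l) k x y,
    sum_sum_mul_mul y fun j l => ∑ m, Nc G m k x y * pdy (Ga G i j l) m x y,
    sum_sum_mul_mul' y fun j l => pdx (Ga G i j k) l x y,
    sum_sum_mul_mul' y fun j l => ∑ m, Nc G m l x y * pdy (Ga G i j k) m x y,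
    sum_sum_mul_mul y fun j l => ∑ s, Ga G i k s x y * Ga G s j l x y,
    sum_sum_mul_mul y fun j l => ∑ s, Ga G s j k x y * Ga G i l s x y]
  have t2 (j) : ∑ l, y l * ∑ m, Nc G m k x y * pdy (Ga G i j l) m x y = 0 := by
    rw [sum_mul_sum_mul_comm]
    simp only [cΓ, mul_zero, Finset.sum_const_zero]
  have t4 (l) : ∑ j, y j * ∑ m, Nc G m l x y * pdy (Ga G i j k) m x y = 0 := by
    rw [sum_mul_sum_mul_comm]
    simp only [cΓ', mul_zero, Finset.sum_const_zero]
  have t5 : ∑ j, y j * ∑ l, y l * ∑ s, Ga G i k s x y * Ga G s j l x y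
      = 2 * ∑ s, Ga G i k s x y * G s x y := by
    have inner (j) : ∑ l, y l * ∑ s, Ga G i k s x y * Ga G s j l x y
        = ∑ s, Ga G i k s x y * Nc G s j x y := by
      rw [sum_mul_sum_mul_comm]
      simp only [cN]
    simp only [inner]
    rw [sum_mul_sum_mul_comm]
    simp only [cG, mul_left_comm _ (2 : ℝ), ← Finset.mul_sum]
  have t6 : ∑ j, y j * ∑ l, y l * ∑ s, Ga G s j k x y * Ga G i l s x y
      = ∑ s, Nc G i s x y * Nc G s k x y := by
    have inner (j) : ∑ l, y l * ∑ s, Ga G s j k x y * Ga G i l s x y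
        = ∑ s, Nc G i s x y * Ga G s j k x y := by
      rw [sum_mul_sum_mul_comm]
      simp only [cN', mul_comm]
    simp only [inner]
    rw [sum_mul_sum_mul_comm]
    simp only [cN']
  simp only [t2, t4, t5, t6, cxN, cxG, cxN', mul_zero, Finset.sum_const_zero]
  ring

lemma pdy_Riem2 (hW : IsOpen W) (hG : ∀ i, JointlySmooth W (G i))
    (he : ∀ i, EulerOn W 2 (G i)) (h : (x, y) ∈ W) (i k j : Fin n) :
    pdy (Riem2 G i k) j x y = 2 * pdx (Nc G i j) k x y - pdx (Nc G i k) j x y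
      - ∑ l, y l * pdx (Ga G i k j) l x y
      + 2 * ∑ s, (pdy (Ga G i k s) j x y * G s x y + Ga G i k s x y * Nc G s j x y)
      - ∑ s, (Ga G i s j x y * Nc G s k x y + Nc G i s x y * Ga G s k j x y) := by
  have hN := jointlySmooth_Nc hW hG
  have hΓ := jointlySmooth_Ga hW hG
  let F : Vec n → Vec n → ℝ := fun x y =>
    2 * pdx (G i) k x y - ∑ l, y l * pdx (Nc G i k) l x y
      + 2 * ∑ s, Ga G i k s x y * G s x y - ∑ s, Nc G i s x y * Nc G s k x y
  have hF : JointlySmooth W F := by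
    refine ((ContDiffOn.sub (contDiffOn_const.mul ((hG i).pdx hW k)) (ContDiffOn.sum fun l _ =>
      (jointlySmooth_coord l).mul ((hN i k).pdx hW l))).add (contDiffOn_const.mul
      (ContDiffOn.sum fun s _ => (hΓ i k s).mul (hG s)))).sub
      (ContDiffOn.sum fun s _ => (hN i s).mul (hN s k))
  have hF' := ((((((hG i).pdx hW k).hasDerivAt_pdy hW h j).const_mul 2).sub
    (HasDerivAt.fun_sum fun l (_ : l ∈ Finset.univ) => (hasDerivAt_coord y l j).mul
      (((hN i k).pdx hW l).hasDerivAt_pdy hW h j))).add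
    ((HasDerivAt.fun_sum fun s (_ : s ∈ Finset.univ) => ((hΓ i k s).hasDerivAt_pdy hW h j).mul
      ((hG s).hasDerivAt_pdy hW h j)).const_mul 2)).sub
    (HasDerivAt.fun_sum fun s (_ : s ∈ Finset.univ) => ((hN i s).hasDerivAt_pdy hW h j).mul
      ((hN s k).hasDerivAt_pdy hW h j))
  rw [pdy_congr_s8 hW (fun x y h => Riem2_eq hW hG he h i k) h,
    (hF.hasDerivAt_pdy hW h j).unique hF']
  simp only [(hG i).pdy_pdx_comm hW h, (hN i k).pdy_pdx_comm hW h, zero_smul, add_zero,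
    Finset.sum_add_distrib, Pi.single_apply, ite_mul, one_mul, zero_mul, Finset.sum_ite_eq',
    Finset.mem_univ, if_true, pdy_eq_Nc (G := G), pdy_Nc]
  ring

end Spray

/-- the local-coordinate formula
`χ_k = (1/2)((∂²Π/∂x^m∂y^k) y^m − ∂Π/∂x^k − 2 (∂²Π/∂y^k∂y^m) G^m)`. -/
theorem chi_local_formula
    {n : ℕ} (hn : 2 ≤ n) (U : Set (Vec n)) (hU : IsOpen U)
    (G : Fin n → Vec n → Vec n → ℝ) (hG : IsSpray U G) :
    ∀ x ∈ U, ∀ y : Vec n, y ≠ 0 → ∀ k,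
      chi G k x y
        = (1 / 2) *
            ((∑ m, pdx (fun x' y' => pdy (PiG G) k x' y') m x y * y m)
              - pdx (PiG G) k x y
              - 2 * ∑ m, pdy (fun x' y' => pdy (PiG G) m x' y') k x y * G m x y) := by
  intro x hx y hy k
  set W : Set (Vec n × Vec n) := U ×ˢ {y : Vec n | y ≠ 0}
  have hW : IsOpen W := hU.prod isOpen_ne
  have h : (x, y) ∈ W := ⟨hx, hy⟩
  have hS : ∀ i, JointlySmooth W (G i) := hG.1
  have he (i) : EulerOn W 2 (G i) := by
    simpa using eulerOn_of_homogeneous (hS i) hW 2 (hG.2 i)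
  have hN := jointlySmooth_Nc hW hS
  have hΓ := jointlySmooth_Ga hW hS
  have hP (j) : ∀ x y, (x, y) ∈ W → pdy (PiG G) j x y = ∑ i, Ga G i i j x y :=
    fun x y h => pdy_sum (fun i _ => hN i i) hW h j
  have hxP : pdx (PiG G) k x y = ∑ i, pdx (Nc G i i) k x y :=
    pdx_sum (fun i _ => hN i i) hW h k
  have hxyP (m) : pdx (fun x' y' => pdy (PiG G) k x' y') m x y
      = ∑ i, pdx (Ga G i i k) m x y := by
    rw [pdx_congr_s8 hW (hP k) h, pdx_sum (fun i _ => hΓ i i k) hW h]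
  have hyyP (m) : pdy (fun x' y' => pdy (PiG G) m x' y') k x y
      = ∑ i, pdy (Ga G i i m) k x y := by
    rw [pdy_congr_s8 hW (hP m) h, pdy_sum (fun i _ => hΓ i i m) hW h]
  have hxΓ (m l) : pdx (Ga G m k m) l x y = pdx (Ga G m m k) l x y :=
    pdx_congr_s8 hW (fun x y h => Ga_symm hW hS h m k m) h l
  have hyΓ (m s) : pdy (Ga G m k s) m x y = pdy (Ga G m m s) k x y := by
    rw [← pdy_Nc, (hN m k).pdy_pdy_comm hW h, pdy_Nc,
      pdy_congr_s8 hW (fun x y h => Ga_symm hW hS h m k m) h,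
      ← pdy_Nc, (hN m m).pdy_pdy_comm hW h, pdy_Nc]
  have hswap : ∑ m, ∑ s, Nc G m s x y * Ga G s k m x y
      = ∑ m, ∑ s, Ga G m k s x y * Nc G s m x y := by
    rw [Finset.sum_comm]
    exact Finset.sum_congr rfl fun m _ => Finset.sum_congr rfl fun s _ => mul_comm _ _
  have hcommx : ∑ m, ∑ i, pdx (Ga G i i k) m x y * y m
      = ∑ m, ∑ l, y l * pdx (Ga G m m k) l x y := by
    rw [Finset.sum_comm]
    exact Finset.sum_congr rfl fun m _ => Finset.sum_congr rfl fun s _ => mul_comm _ _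
  have hcommy : ∑ m, ∑ i, pdy (Ga G i i m) k x y * G m x y
      = ∑ m, ∑ s, pdy (Ga G m m s) k x y * G s x y := Finset.sum_comm
  simp only [chi, pdy_Riem2 hW hS he h, hxP, hxyP, hyyP, hxΓ, hyΓ, Finset.sum_mul, hcommx,
    hcommy, Finset.sum_add_distrib, Finset.sum_sub_distrib, ← Finset.mul_sum, hswap,
    fun m s => Ga_symm hW hS h m s k, fun m s => Ga_symm hW hS h m s m]
  ring
end
end

section
/- Let G be a spray of scalar curvature on an open set U ⊆ ℝⁿ (n ≥ 2). Then G is of isotropic curvature if and only if its χ-curvature vanishes: χ_k = 0 for all k. -/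
open scoped BigOperators

noncomputable section

variable {n : ℕ}

/-- Smoothness of `f(x, y)` in both variables, for `x ∈ U` and `y ≠ 0`. -/
def SmoothOff (U : Set (Vec n)) (f : Vec n → Vec n → ℝ) : Prop :=
  ContDiffOn ℝ (⊤ : ℕ∞) (fun p : Vec n × Vec n => f p.1 p.2) (U ×ˢ {y : Vec n | y ≠ 0})

namespace SmoothOff

variable {U : Set (Vec n)} {f g : Vec n → Vec n → ℝ}

theorem isOpen_domain (hU : IsOpen U) : IsOpen (U ×ˢ {y : Vec n | y ≠ 0}) :=
  hU.prod isOpen_ne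

theorem differentiableAt (hf : SmoothOff U f) (hU : IsOpen U) {x y : Vec n} (hx : x ∈ U)
    (hy : y ≠ 0) : DifferentiableAt ℝ (fun p : Vec n × Vec n => f p.1 p.2) (x, y) :=
  have hmem : (x, y) ∈ U ×ˢ {y : Vec n | y ≠ 0} := ⟨hx, hy⟩
  (ContDiffOn.contDiffAt hf ((isOpen_domain hU).mem_nhds hmem)).differentiableAt (by simp)

theorem differentiableAt_right (hf : SmoothOff U f) (hU : IsOpen U) {x y : Vec n} (hx : x ∈ U)
    (hy : y ≠ 0) : DifferentiableAt ℝ (fun y' => f x y') y :=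
  DifferentiableAt.comp (f := fun y' : Vec n => (x, y')) y (hf.differentiableAt hU hx hy)
    (by fun_prop)

theorem fderiv_apply (hf : SmoothOff U f) (hU : IsOpen U) (v : Vec n × Vec n) :
    ContDiffOn ℝ (⊤ : ℕ∞) (fun p => fderiv ℝ (fun p : Vec n × Vec n => f p.1 p.2) p v)
      (U ×ˢ {y : Vec n | y ≠ 0}) :=
  (ContDiffOn.fderiv_of_isOpen hf (isOpen_domain hU) (by simp)).clm_apply contDiffOn_const

theorem pdy (hf : SmoothOff U f) (hU : IsOpen U) (k : Fin n) : SmoothOff U (pdy f k) := by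
  refine (hf.fderiv_apply hU (0, Pi.single k 1)).congr ?_
  rintro ⟨x, y⟩ ⟨hx, hy⟩
  have h := (hf.differentiableAt hU hx hy).hasFDerivAt.comp y
    (hasFDerivAt_prodMk_right (𝕜 := ℝ) x y)
  have h' : HasFDerivAt (fun y' => f x y') _ y := h
  simp [_root_.pdy, h'.fderiv]

theorem pdx (hf : SmoothOff U f) (hU : IsOpen U) (k : Fin n) : SmoothOff U (pdx f k) := by
  refine (hf.fderiv_apply hU (Pi.single k 1, 0)).congr ?_
  rintro ⟨x, y⟩ ⟨hx, hy⟩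
  have h := (hf.differentiableAt hU hx hy).hasFDerivAt.comp x
    (hasFDerivAt_prodMk_left (𝕜 := ℝ) x y)
  have h' : HasFDerivAt (fun x' => f x' y) _ x := h
  simp [_root_.pdx, h'.fderiv]

theorem mul (hf : SmoothOff U f) (hg : SmoothOff U g) :
    SmoothOff U (fun x y => f x y * g x y) := ContDiffOn.mul hf hg

theorem add (hf : SmoothOff U f) (hg : SmoothOff U g) :
    SmoothOff U (fun x y => f x y + g x y) := ContDiffOn.add hf hg

theorem sub (hf : SmoothOff U f) (hg : SmoothOff U g) :
    SmoothOff U (fun x y => f x y - g x y) := ContDiffOn.sub hf hg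

theorem sum {ι : Type*} [Fintype ι] {f : ι → Vec n → Vec n → ℝ} (hf : ∀ i, SmoothOff U (f i)) :
    SmoothOff U (fun x y => ∑ i, f i x y) := ContDiffOn.sum fun i _ => hf i

theorem const (c : ℝ) : SmoothOff U (fun _ _ => c) := contDiffOn_const

theorem coord (j : Fin n) : SmoothOff U (fun _ y => y j) :=
  ContDiff.contDiffOn (by fun_prop)

end SmoothOff

namespace IsSpray

variable {U : Set (Vec n)} {G : Fin n → Vec n → Vec n → ℝ}

theorem smoothOff_Nc (hG : IsSpray U G) (hU : IsOpen U) (i j : Fin n) : SmoothOff U (Nc G i j) :=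
  SmoothOff.pdy (hG.1 i) hU j

theorem smoothOff_Ga (hG : IsSpray U G) (hU : IsOpen U) (i j k : Fin n) :
    SmoothOff U (Ga G i j k) :=
  (hG.smoothOff_Nc hU i j).pdy hU k

theorem smoothOff_hd (hG : IsSpray U G) (hU : IsOpen U) {f : Vec n → Vec n → ℝ}
    (hf : SmoothOff U f) (k : Fin n) : SmoothOff U (hd G f k) :=
  (hf.pdx hU k).sub (.sum fun m => (hG.smoothOff_Nc hU m k).mul (hf.pdy hU m))

theorem smoothOff_Riem4 (hG : IsSpray U G) (hU : IsOpen U) (j i k l : Fin n) :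
    SmoothOff U (Riem4 G j i k l) :=
  have hΓ := hG.smoothOff_Ga hU
  ((hG.smoothOff_hd hU (hΓ i j l) k).sub (hG.smoothOff_hd hU (hΓ i j k) l)).add
    (.sum fun s => ((hΓ i k s).mul (hΓ s j l)).sub ((hΓ s j k).mul (hΓ i l s)))

theorem smoothOff_Riem2 (hG : IsSpray U G) (hU : IsOpen U) (i k : Fin n) :
    SmoothOff U (Riem2 G i k) :=
  .sum fun j => .sum fun l => ((SmoothOff.coord j).mul (hG.smoothOff_Riem4 hU j i k l)).mul
    (SmoothOff.coord l)

theorem smoothOff_Rsc (hG : IsSpray U G) (hU : IsOpen U) : SmoothOff U (Rsc G) :=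
  (SmoothOff.const _).mul (.sum fun m => hG.smoothOff_Riem2 hU m m)

end IsSpray

/-- Euler's relation for positively homogeneous functions of degree one. -/
theorem fderiv_apply_self_of_posHomogeneous {E : Type*} [NormedAddCommGroup E] [NormedSpace ℝ E]
    {f : E → ℝ} {y : E} (hf : DifferentiableAt ℝ f y)
    (hom : ∀ c : ℝ, 0 < c → f (c • y) = c * f y) : fderiv ℝ f y y = f y := by
  have hline : HasDerivAt (fun c : ℝ => c • y) y 1 := by
    simpa using (hasDerivAt_id (1 : ℝ)).smul_const y
  have hf' : HasFDerivAt f (fderiv ℝ f y) ((1 : ℝ) • y) := by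
    simpa using hf.hasFDerivAt
  have hcomp : HasDerivAt (fun c : ℝ => f (c • y)) (fderiv ℝ f y y) 1 :=
    hf'.comp_hasDerivAt (1 : ℝ) hline
  have hlin : HasDerivAt (fun c : ℝ => c * f y) (f y) 1 := by
    simpa using (hasDerivAt_id (1 : ℝ)).mul_const (f y)
  refine hcomp.unique (hlin.congr_of_eventuallyEq ?_)
  filter_upwards [lt_mem_nhds (zero_lt_one' ℝ)] with c hc using hom c hc

theorem sum_pdy_mul_coord (f : Vec n → Vec n → ℝ) (x y : Vec n) :
    ∑ m, pdy f m x y * y m = fderiv ℝ (fun y' => f x y') y y := by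
  have h : ∑ m, y m • (Pi.single m 1 : Vec n) = y := by
    ext j
    simp [Pi.single_apply]
  conv_rhs => rw [← congrArg (fderiv ℝ (fun y' => f x y') y) h, map_sum]
  exact Finset.sum_congr rfl fun m _ => by rw [map_smul, smul_eq_mul, mul_comm, pdy]

/-- A coefficient `τ k` in `Rⁱ_k = R δⁱ_k − τ_k yⁱ` is differentiable, as it is locally a
quotient by a nonvanishing coordinate. -/
theorem differentiableAt_scalarCurv_coeff {U : Set (Vec n)} (hU : IsOpen U)
    {G : Fin n → Vec n → Vec n → ℝ} (hG : IsSpray U G) {τ : Fin n → Vec n → Vec n → ℝ}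
    (hR : ∀ x ∈ U, ∀ y : Vec n, y ≠ 0 → ∀ i k, Riem2 G i k x y
      = Rsc G x y * (if i = k then 1 else 0) - τ k x y * y i)
    {x y : Vec n} (hx : x ∈ U) (hy : y ≠ 0) (k : Fin n) :
    DifferentiableAt ℝ (fun y' => τ k x y') y := by
  obtain ⟨i, hi⟩ := Function.ne_iff.mp hy
  have hquot : DifferentiableAt ℝ (fun y' : Vec n =>
      (Rsc G x y' * (if i = k then 1 else 0) - Riem2 G i k x y') * (y' i)⁻¹) y :=
    ((((hG.smoothOff_Rsc hU).differentiableAt_right hU hx hy).mul_const _).fun_sub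
      ((hG.smoothOff_Riem2 hU i k).differentiableAt_right hU hx hy)).fun_mul
        ((differentiableAt_apply (𝕜 := ℝ) i y).inv hi)
  refine hquot.congr_of_eventuallyEq ?_
  have hcont : ContinuousAt (fun y' : Vec n => y' i) y :=
    (continuous_apply i).continuousAt
  filter_upwards [hcont.eventually_ne hi, isOpen_ne.mem_nhds hy] with z hzi hz
  rw [eq_mul_inv_iff_mul_eq₀ hzi, hR x hx z hz i k]
  ring

/-- The χ-curvature of a spray of scalar curvature is `-((n+1)/6) (R_{·k} - 2 τ_k)`. -/
theorem chi_eq_of_scalarCurv (hn : 2 ≤ n) {U : Set (Vec n)} (hU : IsOpen U)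
    {G : Fin n → Vec n → Vec n → ℝ} (hG : IsSpray U G) {τ : Fin n → Vec n → Vec n → ℝ}
    (hom : ∀ k (x y : Vec n) (lam : ℝ), 0 < lam → τ k x (lam • y) = lam * τ k x y)
    (hR : ∀ x ∈ U, ∀ y : Vec n, y ≠ 0 → ∀ i k, Riem2 G i k x y
      = Rsc G x y * (if i = k then 1 else 0) - τ k x y * y i)
    {x y : Vec n} (hx : x ∈ U) (hy : y ≠ 0) (k : Fin n) :
    chi G k x y = -(((n : ℝ) + 1) / 6) * (pdy (Rsc G) k x y - 2 * τ k x y) := by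
  have hRd := (hG.smoothOff_Rsc hU).differentiableAt_right hU hx hy
  have hτd := differentiableAt_scalarCurv_coeff hU hG hR hx hy k
  have hn1 : (n : ℝ) - 1 ≠ 0 := by
    have : (2 : ℝ) ≤ n := by exact_mod_cast hn
    linarith
  have hdiv (m : Fin n) : pdy (Riem2 G m k) m x y
      = pdy (Rsc G) m x y * (if m = k then 1 else 0) - (pdy (τ k) m x y * y m + τ k x y) := by
    have hev : (fun y' => Riem2 G m k x y') =ᶠ[nhds y]
        fun y' => Rsc G x y' * (if m = k then 1 else 0) - τ k x y' * y' m := by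
      filter_upwards [isOpen_ne.mem_nhds hy] with z hz using hR x hx z hz m k
    have hcoord : HasFDerivAt (fun y' : Vec n => y' m)
        (ContinuousLinearMap.proj (R := ℝ) (φ := fun _ : Fin n => ℝ) m) y :=
      (ContinuousLinearMap.proj (R := ℝ) (φ := fun _ : Fin n => ℝ) m).hasFDerivAt
    have hder := (hRd.hasFDerivAt.mul_const (if m = k then (1 : ℝ) else 0)).fun_sub
      (hτd.hasFDerivAt.fun_mul hcoord)
    simp only [pdy]
    rw [hev.fderiv_eq, hder.fderiv]
    split_ifs <;> simp <;> ring
  have htrace : ∑ m, pdy (Riem2 G m m) k x y = ((n : ℝ) - 1) * pdy (Rsc G) k x y := by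
    have hder : HasFDerivAt (fun y' => ∑ m, Riem2 G m m x y')
        (∑ m, fderiv ℝ (fun y' => Riem2 G m m x y') y) y :=
      HasFDerivAt.fun_sum fun m _ =>
        ((hG.smoothOff_Riem2 hU m m).differentiableAt_right hU hx hy).hasFDerivAt
    have hRsc : HasFDerivAt (fun y' => Rsc G x y') _ y :=
      hder.const_mul (1 / ((n : ℝ) - 1))
    simp only [pdy]
    rw [hRsc.fderiv]
    simp [hn1]
  have heuler : ∑ m, pdy (τ k) m x y * y m = τ k x y := by
    rw [sum_pdy_mul_coord]
    exact fderiv_apply_self_of_posHomogeneous hτd fun c hc => hom k x y c hc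
  rw [chi, htrace, Finset.sum_congr rfl fun m _ => hdiv m, Finset.sum_sub_distrib,
    Finset.sum_add_distrib, heuler]
  simp
  ring

/-- a spray of scalar curvature is of isotropic curvature iff `χ = 0`. -/
theorem isotropic_iff_chi_zero_of_scalar
    {n : ℕ} (hn : 2 ≤ n) (U : Set (Vec n)) (hU : IsOpen U)
    (G : Fin n → Vec n → Vec n → ℝ) (hG : IsSpray U G)
    (hscal : IsScalarCurv U G) :
    IsIsotropicCurv U G ↔ (∀ x ∈ U, ∀ y : Vec n, y ≠ 0 → ∀ k, chi G k x y = 0) := by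
  obtain ⟨τ, hom, hτ⟩ := hscal
  have hR := fun x hx y hy => (hτ x hx y hy).2
  refine forall₄_congr fun x hx y hy => ?_
  have hchi (k : Fin n) : chi G k x y = 0 ↔ τ k x y = 1 / 2 * pdy (Rsc G) k x y := by
    have hn1 : -(((n : ℝ) + 1) / 6) ≠ 0 := neg_ne_zero.mpr (by positivity)
    rw [chi_eq_of_scalarCurv hn hU hG hom hR hx hy, mul_eq_zero, or_iff_right hn1]
    constructor <;> intro h <;> linarith
  simp only [hchi]
  constructor
  · intro h k
    obtain ⟨i, hi⟩ := Function.ne_iff.mp hy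
    refine mul_right_cancel₀ hi ?_
    linarith [h i k, hR x hx y hy i k]
  · intro h i k
    rw [hR x hx y hy i k, h k]
end
end
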